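/- arXiv:0710.4998 — 3 statements merged into one kernel-verified Lean document; each statement's English description precedes it below -/
import Mathlib

section
/- A nonnegative integer n is represented by the quaternary quadratic form x₁² + x₁x₂ + 2x₂² + 14y₁² + 14y₁y₂ + 28y₂² if and only if n ≡ 0, 1, 2 or 4 (mod 7). (This settles Rokicki's candidate: the binary Hermitian lattice ⟨1,14⟩ over ℚ(√-7) is regular; stated for its associated quadratic form.) -/
/-- The norm form `x² + xy + 2y²` of the ring of integers of `ℚ(√-7)`. -/
def normForm (x y : ℤ) : ℤ := x ^ 2 + x * y + 2 * y ^ 2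

/-- `k` is represented by the integral ternary form
`a x² + p xy + q xz + A y² + B yz + C z²`, which is positive definite of discriminant `7`. -/
def RepByTernary (k a p q A B C : ℤ) : Prop :=
  0 < a ∧ 0 < 4 * a * A - p ^ 2 ∧
    4 * a * A * C + p * q * B - a * B ^ 2 - A * q ^ 2 - C * p ^ 2 = 7 ∧
    ∃ x y z : ℤ, a * x ^ 2 + p * x * y + q * x * z + A * y ^ 2 + B * y * z + C * z ^ 2 = k

namespace RepByTernary

variable {k a p q A B C : ℤ}

theorem shift_x_y (h : RepByTernary k a p q A B C) (t : ℤ) :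
    RepByTernary k a (p + 2 * a * t) q (A + p * t + a * t ^ 2) (B + q * t) C := by
  obtain ⟨h1, h2, h3, x, y, z, h4⟩ := h
  refine ⟨h1, ?_, ?_, x - t * y, y, z, ?_⟩
  · linear_combination h2
  · linear_combination h3
  · linear_combination h4

theorem shift_x_z (h : RepByTernary k a p q A B C) (t : ℤ) :
    RepByTernary k a p (q + 2 * a * t) A (B + p * t) (C + q * t + a * t ^ 2) := by
  obtain ⟨h1, h2, h3, x, y, z, h4⟩ := h
  refine ⟨h1, h2, ?_, x - t * z, y, z, ?_⟩
  · linear_combination h3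
  · linear_combination h4

theorem shift_y_z (h : RepByTernary k a p q A B C) (t : ℤ) :
    RepByTernary k a p (q + p * t) A (B + 2 * A * t) (C + B * t + A * t ^ 2) := by
  obtain ⟨h1, h2, h3, x, y, z, h4⟩ := h
  refine ⟨h1, h2, ?_, x, y - t * z, z, ?_⟩
  · linear_combination h3
  · linear_combination h4

theorem binary_disc (h : RepByTernary k a p q A B C) :
    (4 * a * A - p ^ 2) * (4 * a * C - q ^ 2) = (2 * a * B - p * q) ^ 2 + 28 * a := by
  linear_combination 4 * a * h.2.2.1

theorem swap_y_z (h : RepByTernary k a p q A B C) : RepByTernary k a q p C B A := by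
  have hd := h.binary_disc
  obtain ⟨h1, h2, h3, x, y, z, h4⟩ := h
  refine ⟨h1, (pos_iff_pos_of_mul_pos (a := 4 * a * A - p ^ 2) ?_).1 h2, ?_, x, z, y, ?_⟩
  · rw [hd]; positivity
  · linear_combination h3
  · linear_combination h4

theorem swap_x_y (h : RepByTernary k a p q A B C) : RepByTernary k A p B a q C := by
  obtain ⟨h1, h2, h3, x, y, z, h4⟩ := h
  refine ⟨?_, ?_, ?_, y, x, z, ?_⟩
  · by_contra! hA
    nlinarith [sq_nonneg p, mul_nonneg h1.le (neg_nonneg.2 hA)]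
  · linear_combination h2
  · linear_combination h3
  · linear_combination h4

end RepByTernary

/-- Any integer can be shifted by a multiple of `2m` into `[-m, m]`. -/
theorem exists_shift_abs_le (b : ℤ) {m : ℤ} (hm : 0 < m) : ∃ t : ℤ, |b + 2 * m * t| ≤ m := by
  refine ⟨-((b + m) / (2 * m)), ?_⟩
  have h1 := Int.emod_add_mul_ediv (b + m) (2 * m)
  have h2 := Int.emod_nonneg (b + m) (by lia : 2 * m ≠ 0)
  have h3 := Int.emod_lt_of_pos (b + m) (by lia : 0 < 2 * m)
  rw [abs_le]
  constructor <;> linarith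

/-- Positive ternary forms of discriminant `7` can be reduced. -/
theorem exists_reduced {k a p q A B C : ℤ} (h : RepByTernary k a p q A B C) :
    ∃ a p q A B C : ℤ, RepByTernary k a p q A B C ∧ |p| ≤ a ∧ |q| ≤ a ∧ a ≤ A ∧
      2 * |2 * a * B - p * q| ≤ 4 * a * A - p ^ 2 ∧
      4 * a * A - p ^ 2 ≤ 4 * a * C - q ^ 2 := by
  classical
  have hex : ∃ n : ℕ, ∃ p q A B C : ℤ, RepByTernary k n p q A B C :=
    ⟨a.toNat, p, q, A, B, C, by rwa [Int.toNat_of_nonneg h.1.le]⟩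
  obtain ⟨p₁, q₁, A₁, B₁, C₁, h₁⟩ := Nat.find_spec hex
  set m := Nat.find hex with hm
  have hmin : ∀ a p q A B C : ℤ, RepByTernary k a p q A B C → (m : ℤ) ≤ a := by
    intro a p q A B C h
    have : m ≤ a.toNat :=
      Nat.find_min' hex ⟨p, q, A, B, C, by rwa [Int.toNat_of_nonneg h.1.le]⟩
    have := h.1
    lia
  have hex' : ∃ n : ℕ, ∃ p q A B C : ℤ, RepByTernary k m p q A B C ∧ 4 * m * A - p ^ 2 = n :=
    ⟨(4 * m * A₁ - p₁ ^ 2).toNat, p₁, q₁, A₁, B₁, C₁, h₁,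
      (Int.toNat_of_nonneg h₁.2.1.le).symm⟩
  obtain ⟨p₂, q₂, A₂, B₂, C₂, h₂, hα⟩ := Nat.find_spec hex'
  set α := Nat.find hex' with hα'
  have hmin' : ∀ p q A B C : ℤ, RepByTernary k m p q A B C → (α : ℤ) ≤ 4 * m * A - p ^ 2 := by
    intro p q A B C h
    have : α ≤ (4 * m * A - p ^ 2).toNat :=
      Nat.find_min' hex' ⟨p, q, A, B, C, h, (Int.toNat_of_nonneg h.2.1.le).symm⟩
    have := h.2.1
    lia
  have hαpos : (0 : ℤ) < α := hα ▸ h₂.2.1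
  obtain ⟨t, ht⟩ := exists_shift_abs_le (2 * (2 * m * B₂ - p₂ * q₂)) hαpos
  have h₃ := h₂.shift_y_z t
  obtain ⟨u, hu⟩ := exists_shift_abs_le p₂ h₃.1
  have h₄ := h₃.shift_x_y u
  obtain ⟨v, hv⟩ := exists_shift_abs_le (q₂ + p₂ * t) h₃.1
  have h₅ := h₄.shift_x_z v
  refine ⟨_, _, _, _, _, _, h₅, hu, hv, hmin _ _ _ _ _ _ h₅.swap_x_y, ?_, ?_⟩
  · rw [← abs_two (α := ℤ), ← abs_mul]
    convert ht using 1
    · congr 1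
      linear_combination (2 * t) * hα
    · linear_combination hα
  · calc _ = (α : ℤ) := by linear_combination hα
      _ ≤ _ := hmin' _ _ _ _ _ h₅.swap_y_z

/-- There is only one class of positive ternary forms of discriminant `7`. -/
theorem RepByTernary.eq_sq_add_normForm {k a p q A B C : ℤ} (h : RepByTernary k a p q A B C) :
    ∃ b x y : ℤ, k = b ^ 2 + normForm x y := by
  obtain ⟨a, p, q, A, B, C, h, hp, hq, haA, hβ, hαγ⟩ := exists_reduced h
  have hd := h.binary_disc
  obtain ⟨ha, hα, hdisc, x, y, z, hk⟩ := h
  generalize hα' : 4 * a * A - p ^ 2 = α at *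
  generalize hγ' : 4 * a * C - q ^ 2 = γ at *
  generalize hβ' : 2 * a * B - p * q = β at *
  have hp2 : p ^ 2 ≤ a ^ 2 := sq_le_sq' (abs_le.1 hp).1 (abs_le.1 hp).2
  have hβ2 : 4 * β ^ 2 ≤ α ^ 2 := by
    have := pow_le_pow_left₀ (by positivity) hβ 2
    rw [mul_pow, sq_abs] at this
    linarith
  have hα2 : 3 * α ^ 2 ≤ 112 * a := by nlinarith
  have hαa : 3 * a ^ 2 ≤ α := by nlinarith
  have ha1 : a = 1 := by
    by_contra hne
    have h2 : 2 ≤ a := by lia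
    have : 9 * (a ^ 2) ^ 2 ≤ α ^ 2 := by nlinarith
    nlinarith [mul_pos ha ha, mul_nonneg (sub_nonneg.2 h2) (mul_pos ha ha).le,
      mul_pos ha (mul_pos ha ha), mul_nonneg (sub_nonneg.2 h2) (mul_pos ha (mul_pos ha ha)).le]
  subst ha1
  have hα6 : α ≤ 6 := by nlinarith
  rw [abs_le] at hp hq
  obtain ⟨hp1, hp2⟩ := hp
  obtain ⟨hq1, hq2⟩ := hq
  obtain ⟨hβ1, hβ2⟩ : -3 ≤ β ∧ β ≤ 3 := abs_le.1 (by lia)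
  obtain rfl : A = 1 := by nlinarith
  have hp0 : p = 0 := by
    interval_cases p
    · obtain rfl : α = 3 := by linarith
      obtain ⟨h1, h2⟩ : -1 ≤ β ∧ β ≤ 1 := abs_le.1 (by lia)
      interval_cases β <;> lia
    · rfl
    · obtain rfl : α = 3 := by linarith
      obtain ⟨h1, h2⟩ : -1 ≤ β ∧ β ≤ 1 := abs_le.1 (by lia)
      interval_cases β <;> lia
  subst hp0
  unfold normForm
  have hB1 : -1 ≤ B := by lia
  have hB2 : B ≤ 1 := by lia
  interval_cases q <;> interval_cases B <;> try lia
  · obtain rfl : C = 2 := by lia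
    exact ⟨y, x, -z, by linear_combination -hk⟩
  · obtain rfl : C = 2 := by lia
    exact ⟨x, y, -z, by linear_combination -hk⟩
  · obtain rfl : C = 2 := by lia
    exact ⟨x, y, z, by linear_combination -hk⟩
  · obtain rfl : C = 2 := by lia
    exact ⟨y, x, z, by linear_combination -hk⟩

/-- By Dirichlet's theorem and quadratic reciprocity there are a prime `p = 4kδ - 7` and `δ > 0`
such that `-δ` is a square modulo `p`. -/
theorem exists_prime_dvd_sq_add {k : ℤ} (hk : 0 < k) (hk7 : ¬ 7 ∣ k) :
    ∃ (p : ℕ) (δ : ℤ), p.Prime ∧ 0 < δ ∧ (p : ℤ) = 4 * k * δ - 7 ∧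
      ∃ b : ℤ, (p : ℤ) ∣ b ^ 2 + δ := by
  lift k to ℕ using hk.le
  have hk0 : 0 < k := by exact_mod_cast hk
  have h7 : IsCoprime (7 : ℤ) k := (Prime.coprime_iff_not_dvd (by norm_num)).2 hk7
  have hcop : IsCoprime (4 * k - 7 : ℤ) ((112 * k : ℕ) : ℤ) := by
    have h7k : IsCoprime (4 * k - 7 : ℤ) 7 := by
      have : IsCoprime (4 * k : ℤ) 7 := (by norm_num : IsCoprime (4 : ℤ) 7).mul_left h7.symm
      simpa [sub_eq_add_neg] using this.add_mul_left_left (-1)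
    have hkk : IsCoprime (4 * k - 7 : ℤ) k := by
      rw [show (4 * k - 7 : ℤ) = -7 + k * 4 by ring]
      exact h7.neg_left.add_mul_left_left 4
    have h2 : IsCoprime (4 * k - 7 : ℤ) 2 := ⟨-1, 2 * k - 3, by ring⟩
    have : ((112 * k : ℕ) : ℤ) = 2 ^ 4 * 7 * k := by push_cast; ring
    rw [this]
    exact ((h2.pow_right).mul_right h7k).mul_right hkk
  obtain ⟨p, hpgt, hp, hmod⟩ :=
    Nat.forall_exists_prime_gt_and_zmodEq (4 * k) (by positivity : 112 * k ≠ 0) hcop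
  obtain ⟨t, ht⟩ := hmod.symm.dvd
  have ht0 : 0 ≤ t := by
    by_contra! hlt
    push_cast at ht
    nlinarith
  lift t to ℕ using ht0
  have hpδ : (p : ℤ) = 4 * k * ((28 * t + 1 : ℕ) : ℤ) - 7 := by
    push_cast at ht ⊢
    linarith
  refine ⟨p, (28 * t + 1 : ℕ), hp, by positivity, hpδ, ?_⟩
  set δ := 28 * t + 1 with hδ
  have hδodd : Odd δ := ⟨14 * t, by lia⟩
  have hδ4 : δ % 4 = 1 := by lia
  have hp4 : p % 4 = 1 := by
    have : (p : ℤ) = 4 * (k * δ - 2) + 1 := by rw [hpδ]; ring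
    lia
  have hpodd : Odd p := Nat.odd_iff.2 (by lia)
  have := Fact.mk hp
  have hj : jacobiSym (-δ) p = 1 := by
    rw [jacobiSym.neg _ hpodd, ZMod.χ₄_nat_one_mod_four hp4, one_mul,
      jacobiSym.quadratic_reciprocity_one_mod_four hδ4 hpodd,
      jacobiSym.mod_left' (a₂ := -7) (Int.modEq_iff_dvd.2 ⟨-4 * k, by rw [hpδ]; ring⟩),
      jacobiSym.neg _ hδodd, ZMod.χ₄_nat_one_mod_four hδ4, one_mul]
    have h := jacobiSym.quadratic_reciprocity_one_mod_four' (a := 7) (by decide) hδ4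
    rw [Nat.cast_ofNat] at h
    rw [h, jacobiSym.mod_left' (a₂ := 1) (by rw [hδ]; push_cast; lia), jacobiSym.one_left]
  obtain ⟨c, hc⟩ := ZMod.isSquare_of_jacobiSym_eq_one hj
  refine ⟨c.val, ?_⟩
  rw [← ZMod.intCast_zmod_eq_zero_iff_dvd]
  push_cast at hc ⊢
  rw [ZMod.natCast_zmod_val, sq, ← hc]
  ring

/-- The class number one form `b² + x² + xy + 2y²` represents all positive integers prime to `7`. -/
theorem exists_eq_sq_add_normForm {k : ℤ} (hk : 0 < k) (hk7 : ¬ 7 ∣ k) :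
    ∃ b x y : ℤ, k = b ^ 2 + normForm x y := by
  obtain ⟨p, δ, hp, hδ, hpδ, b, a, ha⟩ := exists_prime_dvd_sq_add hk hk7
  have hp0 : (0 : ℤ) < p := by exact_mod_cast hp.pos
  have ha0 : 0 < a := by
    refine (pos_iff_pos_of_mul_pos ?_).1 hp0
    rw [← ha]
    positivity
  refine RepByTernary.eq_sq_add_normForm (a := a) (p := 2 * b) (q := 1) (A := p) (B := 0) (C := k)
    ⟨ha0, ?_, ?_, 0, 0, 1, by ring⟩
  · linear_combination 4 * hδ + 4 * ha
  · linear_combination (-4 * k) * ha - hpδ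

/-- Either `x + yω` is divisible by a prime above `2`, or it lies in `ℤ[√-7]` and
is congruent to `1` modulo `2` in the maximal order. -/
theorem normForm_eq_two_mul_or (x y : ℤ) :
    (∃ u v : ℤ, normForm x y = 2 * normForm u v) ∨
      ∃ s t : ℤ, x = s - t ∧ y = 2 * t ∧ (s + t) % 2 = 1 := by
  unfold normForm
  obtain ⟨w, rfl | rfl⟩ := Int.even_or_odd' x
  · exact .inl ⟨y, w, by ring⟩
  obtain ⟨t, rfl | rfl⟩ := Int.even_or_odd' y
  · exact .inr ⟨2 * w + 1 + t, t, by ring, rfl, by lia⟩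
  · exact .inl ⟨-(2 * t + 1), w + t + 1, by ring⟩

/-- The Hermitian lattice `⟨1, 2⟩` over `ℤ[(1 + √-7) / 2]` is universal. -/
theorem exists_eq_normForm_add_two_mul (m : ℕ) :
    ∃ x₁ x₂ y₁ y₂ : ℤ, (m : ℤ) = normForm x₁ x₂ + 2 * normForm y₁ y₂ := by
  induction m using Nat.strong_induction_on with
  | _ m ih =>
  rcases Nat.eq_zero_or_pos m with rfl | hm
  · exact ⟨0, 0, 0, 0, by norm_num [normForm]⟩
  by_cases h7 : 7 ∣ m
  · obtain ⟨l, rfl⟩ := h7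
    obtain ⟨x₁, x₂, y₁, y₂, h⟩ := ih l (by lia)
    refine ⟨-x₁ - 4 * x₂, 2 * x₁ + x₂, -y₁ - 4 * y₂, 2 * y₁ + y₂, ?_⟩
    unfold normForm at *
    push_cast
    linear_combination 7 * h
  obtain ⟨b, z₁, z₂, h⟩ :=
    exists_eq_sq_add_normForm (k := m) (by exact_mod_cast hm) (by exact_mod_cast h7)
  obtain ⟨u, v, huv⟩ | ⟨s, t, rfl, rfl, hst⟩ := normForm_eq_two_mul_or z₁ z₂
  · exact ⟨b, 0, u, v, by rw [h, huv]; simp [normForm]⟩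
  obtain ⟨c, rfl | rfl⟩ := Int.even_or_odd' b
  · exact ⟨s - t, 2 * t, 0, c, by rw [h]; unfold normForm; ring⟩
  · obtain ⟨e, he⟩ : ∃ e, s = 2 * e + t - (2 * c + 1) := ⟨(s - t + (2 * c + 1)) / 2, by lia⟩
    subst he
    exact ⟨-2 * t, e + t, e - (2 * c + 1), t, by rw [h]; unfold normForm; ring⟩

/-- If a sum of a square and a norm is `0` or `1` modulo `4`, then the norm can be taken even. -/
theorem exists_eq_sq_add_two_mul_normForm {k b x y : ℤ} (h : k = b ^ 2 + normForm x y)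
    (hk : k % 4 = 0 ∨ k % 4 = 1) : ∃ c u v : ℤ, k = c ^ 2 + 2 * normForm u v := by
  obtain ⟨u, v, huv⟩ | ⟨s, t, rfl, rfl, hst⟩ := normForm_eq_two_mul_or x y
  · exact ⟨b, u, v, by rw [h, huv]⟩
  have hk' : k = b ^ 2 + s ^ 2 + 7 * t ^ 2 := by rw [h]; unfold normForm; ring
  obtain ⟨w, hw⟩ : ∃ w, b = t + 2 * w := by
    refine ⟨(b - t) / 2, ?_⟩
    obtain ⟨b', rfl | rfl⟩ := Int.even_or_odd' b <;>
    obtain ⟨s', rfl | rfl⟩ := Int.even_or_odd' s <;>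
    obtain ⟨t', rfl | rfl⟩ := Int.even_or_odd' t <;>
    ring_nf at hk' <;> lia
  exact ⟨s, 2 * t, w, by rw [hk', hw]; unfold normForm; ring⟩

theorem exists_of_sq_modEq {n a k : ℤ} (hn : n = a ^ 2 + 7 * k) (hk : 0 ≤ k)
    (hk7 : k = 0 ∨ ¬ 7 ∣ k) (hk4 : k % 4 = 0 ∨ k % 4 = 1) :
    ∃ x₁ x₂ y₁ y₂ : ℤ, n = normForm x₁ x₂ + 14 * normForm y₁ y₂ := by
  obtain rfl | hk7 := hk7
  · exact ⟨a, 0, 0, 0, by rw [hn]; simp [normForm]⟩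
  obtain ⟨b, x, y, h⟩ :=
    exists_eq_sq_add_normForm (lt_of_le_of_ne hk (by rintro rfl; simp at hk7)) hk7
  obtain ⟨c, u, v, h⟩ := exists_eq_sq_add_two_mul_normForm h hk4
  exact ⟨a - c, 2 * c, u, v, by rw [hn, h]; unfold normForm; ring⟩

theorem exists_of_odd_of_lt_196 {n : ℕ} (hn : n < 196) (h2 : n % 2 = 1)
    (h7 : n % 7 = 1 ∨ n % 7 = 2 ∨ n % 7 = 4) :
    ∃ x₁ x₂ y₁ y₂ : ℤ, (n : ℤ) = normForm x₁ x₂ + 14 * normForm y₁ y₂ := by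
  have key : ∀ n < 196, n % 2 = 1 → (n % 7 = 1 ∨ n % 7 = 2 ∨ n % 7 = 4) →
      ∃ y < 4, ∃ v < 11, ∃ u < 28, 4 * n = u ^ 2 + 7 * v ^ 2 + 56 * y ^ 2 := by
    decide +kernel
  obtain ⟨y, -, v, -, u, -, h⟩ := key n hn h2 h7
  have huv : ∃ x : ℤ, (u : ℤ) = 2 * x + v := by
    refine ⟨((u : ℤ) - v) / 2, ?_⟩
    obtain ⟨u', rfl | rfl⟩ := Nat.even_or_odd' u <;>
    obtain ⟨v', rfl | rfl⟩ := Nat.even_or_odd' v <;>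
    ring_nf at h <;> push_cast <;> lia
  obtain ⟨x, hx⟩ := huv
  refine ⟨x, v, y, 0, ?_⟩
  have h' : (4 * n : ℤ) = (2 * x + v) ^ 2 + 7 * v ^ 2 + 56 * y ^ 2 := by
    rw [← hx]; exact_mod_cast h
  unfold normForm
  linarith

theorem exists_of_odd {n : ℕ} (h2 : n % 2 = 1) (h7 : n % 7 = 1 ∨ n % 7 = 2 ∨ n % 7 = 4) :
    ∃ x₁ x₂ y₁ y₂ : ℤ, (n : ℤ) = normForm x₁ x₂ + 14 * normForm y₁ y₂ := by
  rcases lt_or_ge n 196 with hlt | hge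
  · exact exists_of_odd_of_lt_196 hlt h2 h7
  have hsq : ∃ a : ℤ, 1 ≤ a ∧ a ≤ 6 ∧ ((n : ℤ) - a ^ 2) % 7 = 0 ∧
      (((n : ℤ) - a ^ 2) % 4 = 0 ∨ ((n : ℤ) - a ^ 2) % 4 = 3) := by
    obtain h4 | h4 : n % 4 = 1 ∨ n % 4 = 3 := by lia
    · obtain h | h | h := h7
      · exact ⟨1, by lia⟩
      · exact ⟨3, by lia⟩
      · exact ⟨5, by lia⟩
    · obtain h | h | h := h7
      · exact ⟨6, by lia⟩
      · exact ⟨4, by lia⟩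
      · exact ⟨2, by lia⟩
  obtain ⟨a, ha1, ha6, ha7, ha4⟩ := hsq
  obtain ⟨k, hk⟩ := Int.dvd_of_emod_eq_zero ha7
  have hge' : (196 : ℤ) ≤ n := by exact_mod_cast hge
  by_cases hk7 : 7 ∣ k
  · refine exists_of_sq_modEq (a := 14 - a) (k := k - 4 * (7 - a)) ?_ ?_ ?_ ?_
    · linear_combination hk
    · nlinarith
    · right; lia
    · lia
  · refine exists_of_sq_modEq (a := a) (k := k) ?_ ?_ (.inr hk7) ?_
    · linear_combination hk
    · nlinarith
    · lia

theorem exists_of_emod_seven (n : ℕ) (h7 : n % 7 = 0 ∨ n % 7 = 1 ∨ n % 7 = 2 ∨ n % 7 = 4) :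
    ∃ x₁ x₂ y₁ y₂ : ℤ, (n : ℤ) = normForm x₁ x₂ + 14 * normForm y₁ y₂ := by
  induction n using Nat.strong_induction_on with
  | _ n ih =>
  obtain h0 | h7 := h7
  · obtain ⟨m, rfl⟩ := Nat.dvd_of_mod_eq_zero h0
    obtain ⟨x₁, x₂, y₁, y₂, h⟩ := exists_eq_normForm_add_two_mul m
    refine ⟨-x₁ - 4 * x₂, 2 * x₁ + x₂, y₁, y₂, ?_⟩
    unfold normForm at *
    push_cast
    linear_combination 7 * h
  obtain ⟨m, rfl | rfl⟩ := Nat.even_or_odd' n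
  · obtain ⟨x₁, x₂, y₁, y₂, h⟩ := ih m (by lia) (by lia)
    refine ⟨-2 * x₂, x₁ + x₂, -2 * y₂, y₁ + y₂, ?_⟩
    unfold normForm at *
    push_cast
    linear_combination 2 * h
  · exact exists_of_odd (by lia) h7

theorem stmt_17 (n : ℤ) (hn : 0 ≤ n) :
    (∃ x1 x2 y1 y2 : ℤ, x1^2 + x1*x2 + 2*x2^2 + 14*y1^2 + 14*y1*y2 + 28*y2^2 = n) ↔
    (n % 7 = 0 ∨ n % 7 = 1 ∨ n % 7 = 2 ∨ n % 7 = 4) := by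
  constructor
  · rintro ⟨x₁, x₂, y₁, y₂, h⟩
    have hmod : n % 7 = (x₁ + 4 * x₂) ^ 2 % 7 :=
      Int.modEq_iff_dvd.2 ⟨x₁ * x₂ + 2 * x₂ ^ 2 - 2 * y₁ ^ 2 - 2 * y₁ * y₂ - 4 * y₂ ^ 2, by
        rw [← h]; ring⟩
    rw [hmod, sq, Int.mul_emod]
    have h1 := Int.emod_nonneg (x₁ + 4 * x₂) (by norm_num : (7 : ℤ) ≠ 0)
    have h2 := Int.emod_lt_of_pos (x₁ + 4 * x₂) (by norm_num : (0 : ℤ) < 7)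
    generalize (x₁ + 4 * x₂) % 7 = r at *
    interval_cases r <;> simp
  · intro h
    lift n to ℕ using hn
    obtain ⟨x₁, x₂, y₁, y₂, h⟩ := exists_of_emod_seven n (by lia)
    exact ⟨x₁, x₂, y₁, y₂, by rw [h]; unfold normForm; ring⟩
end

section
/- A nonnegative integer n is represented by the quaternary quadratic form x₁² + 10x₂² + 5y₁² + 50y₂² if and only if n ≡ 0, 1 or 4 (mod 5). (This is the regularity of the binary Hermitian lattice ⟨1,5⟩ over ℚ(√-10), stated for its associated quadratic form.) -/
/-- The ternary quadratic form with Gram matrix `!![a, t, s; t, b, r; s, r, c]`. -/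
def ternaryForm (a b c r s t x y z : ℤ) : ℤ :=
  a * x ^ 2 + b * y ^ 2 + c * z ^ 2 + 2 * r * y * z + 2 * s * x * z + 2 * t * x * y

/-- Positive definite odd integral ternary forms of determinant `10` which are anisotropic at `5`
and represent `N`. -/
structure IsDetTenForm (N a b c r s t : ℤ) : Prop where
  pos : 0 < a
  minor_pos : 0 < a * b - t ^ 2
  det : a * b * c + 2 * r * s * t - a * r ^ 2 - b * s ^ 2 - c * t ^ 2 = 10
  odd : a % 2 = 1 ∨ b % 2 = 1 ∨ c % 2 = 1
  aniso : ∀ x y z, 5 ∣ ternaryForm a b c r s t x y z →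
    5 ∣ a * x + t * y + s * z ∧ 5 ∣ t * x + b * y + r * z ∧ 5 ∣ s * x + r * y + c * z
  rep : ∃ x y z, ternaryForm a b c r s t x y z = N

namespace IsDetTenForm

variable {N a b c r s t : ℤ}

lemma minor_mul (h : IsDetTenForm N a b c r s t) :
    (a * b - t ^ 2) * (a * c - s ^ 2) = (a * r - s * t) ^ 2 + 10 * a := by
  linear_combination a * h.det

lemma swap_one_two (h : IsDetTenForm N a b c r s t) : IsDetTenForm N b a c s r t where
  pos := by nlinarith [h.pos, h.minor_pos, sq_nonneg t]
  minor_pos := by linarith [h.minor_pos, mul_comm a b]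
  det := by linear_combination h.det
  odd := by have := h.odd; tauto
  aniso x y z hxyz := by
    obtain ⟨h1, h2, h3⟩ := h.aniso y x z (by convert hxyz using 1; simp only [ternaryForm]; ring)
    refine ⟨?_, ?_, ?_⟩
    · convert h2 using 1; ring
    · convert h1 using 1; ring
    · convert h3 using 1; ring
  rep := by
    obtain ⟨x, y, z, hxyz⟩ := h.rep
    exact ⟨y, x, z, by rw [← hxyz]; simp only [ternaryForm]; ring⟩

lemma swap_two_three (h : IsDetTenForm N a b c r s t) : IsDetTenForm N a c b r t s where
  pos := h.pos
  minor_pos := by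
    have h0 := h.minor_mul
    have h1 : 0 < (a * b - t ^ 2) * (a * c - s ^ 2) := by
      rw [h0]; have := h.pos; positivity
    exact pos_of_mul_pos_right h1 h.minor_pos.le
  det := by linear_combination h.det
  odd := by have := h.odd; tauto
  aniso x y z hxyz := by
    obtain ⟨h1, h2, h3⟩ := h.aniso x z y (by convert hxyz using 1; simp only [ternaryForm]; ring)
    refine ⟨?_, ?_, ?_⟩
    · convert h1 using 1; ring
    · convert h3 using 1; ring
    · convert h2 using 1; ring
  rep := by
    obtain ⟨x, y, z, hxyz⟩ := h.rep
    exact ⟨x, z, y, by rw [← hxyz]; simp only [ternaryForm]; ring⟩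

lemma add_one_to_two (h : IsDetTenForm N a b c r s t) (k : ℤ) :
    IsDetTenForm N a (b + 2 * k * t + k ^ 2 * a) c (r + k * s) s (t + k * a) where
  pos := h.pos
  minor_pos := by
    have := h.minor_pos
    linear_combination this
  det := by linear_combination h.det
  odd := by
    rcases Int.emod_two_eq_zero_or_one a with ha | ha
    · obtain ⟨a', rfl⟩ := Int.dvd_of_emod_eq_zero ha
      have h1 : b + 2 * k * t + k ^ 2 * (2 * a') = b + 2 * (k * t + k ^ 2 * a') := by ring
      have := h.odd
      rw [h1]
      omega
    · exact Or.inl ha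
  aniso x y z hxyz := by
    obtain ⟨h1, h2, h3⟩ := h.aniso (x + k * y) y z
      (by convert hxyz using 1; simp only [ternaryForm]; ring)
    refine ⟨?_, ?_, ?_⟩
    · convert h1 using 1; ring
    · have h4 := dvd_add h2 (h1.mul_left k)
      rwa [show t * (x + k * y) + b * y + r * z + k * (a * (x + k * y) + t * y + s * z) =
        (t + k * a) * x + (b + 2 * k * t + k ^ 2 * a) * y + (r + k * s) * z by ring] at h4
    · convert h3 using 1; ring
  rep := by
    obtain ⟨x, y, z, hxyz⟩ := h.rep
    exact ⟨x - k * y, y, z, by rw [← hxyz]; simp only [ternaryForm]; ring⟩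

lemma add_one_to_three (h : IsDetTenForm N a b c r s t) (k : ℤ) :
    IsDetTenForm N a b (c + 2 * k * s + k ^ 2 * a) (r + k * t) (s + k * a) t :=
  (h.swap_two_three.add_one_to_two k).swap_two_three

lemma add_two_to_three (h : IsDetTenForm N a b c r s t) (k : ℤ) :
    IsDetTenForm N a b (c + 2 * k * r + k ^ 2 * b) (r + k * b) (s + k * t) t :=
  (h.swap_one_two.add_one_to_three k).swap_one_two

end IsDetTenForm

lemma exists_centered_residue {a : ℤ} (ha : 0 < a) (t : ℤ) :
    ∃ k, -a ≤ 2 * (t + k * a) ∧ 2 * (t + k * a) ≤ a := by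
  refine ⟨-((2 * t + a) / (2 * a)), ?_⟩
  have h1 := Int.emod_add_mul_ediv (2 * t + a) (2 * a)
  have h2 := Int.emod_nonneg (2 * t + a) (b := 2 * a) (by omega)
  have h3 := Int.emod_lt_of_pos (2 * t + a) (b := 2 * a) (by omega)
  constructor <;> nlinarith

lemma IsDetTenForm.exists_minimal {N a b c r s t : ℤ} (h : IsDetTenForm N a b c r s t) :
    ∃ a b c r s t, IsDetTenForm N a b c r s t ∧
      (∀ a' b' c' r' s' t', IsDetTenForm N a' b' c' r' s' t' → a ≤ a') ∧
      (∀ b' c' r' s' t', IsDetTenForm N a b' c' r' s' t' → a * b - t ^ 2 ≤ a * b' - t' ^ 2) := by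
  classical
  have h1 : ∃ m : ℕ, ∃ a b c r s t, IsDetTenForm N a b c r s t ∧ a = m :=
    ⟨a.toNat, a, b, c, r, s, t, h, by have := h.pos; omega⟩
  obtain ⟨a₀, b₀, c₀, r₀, s₀, t₀, h₀, ha₀⟩ := Nat.find_spec h1
  have h2 : ∃ m : ℕ, ∃ b c r s t, IsDetTenForm N a₀ b c r s t ∧ a₀ * b - t ^ 2 = m :=
    ⟨(a₀ * b₀ - t₀ ^ 2).toNat, b₀, c₀, r₀, s₀, t₀, h₀, by have := h₀.minor_pos; omega⟩
  obtain ⟨b₁, c₁, r₁, s₁, t₁, h₁, hm₁⟩ := Nat.find_spec h2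
  refine ⟨a₀, b₁, c₁, r₁, s₁, t₁, h₁, ?_, ?_⟩
  · intro a' b' c' r' s' t' h'
    have := Nat.find_min' h1 (m := a'.toNat)
      ⟨a', b', c', r', s', t', h', by have := h'.pos; omega⟩
    have := h'.pos
    omega
  · intro b' c' r' s' t' h'
    have := Nat.find_min' h2 (m := (a₀ * b' - t' ^ 2).toNat)
      ⟨b', c', r', s', t', h', by have := h'.minor_pos; omega⟩
    have := h'.minor_pos
    omega

lemma IsDetTenForm.exists_reduced {N a b c r s t : ℤ} (h : IsDetTenForm N a b c r s t) :
    ∃ a b c r s t, IsDetTenForm N a b c r s t ∧ a ≤ b ∧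
      (-a ≤ 2 * t ∧ 2 * t ≤ a) ∧ (-a ≤ 2 * s ∧ 2 * s ≤ a) ∧
      (-(a * b - t ^ 2) ≤ 2 * (a * r - s * t) ∧ 2 * (a * r - s * t) ≤ a * b - t ^ 2) ∧
      a * b - t ^ 2 ≤ a * c - s ^ 2 := by
  obtain ⟨a, b, c, r, s, t, h, hmin, hmin'⟩ := h.exists_minimal
  obtain ⟨k, hk⟩ := exists_centered_residue h.pos t
  have h1 := h.add_one_to_two k
  have hG : a * b - t ^ 2 = a * (b + 2 * k * t + k ^ 2 * a) - (t + k * a) ^ 2 := by ring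
  rw [hG] at hmin'
  generalize b + 2 * k * t + k ^ 2 * a = b at *
  generalize t + k * a = t at *
  generalize r + k * s = r at *
  obtain ⟨l, hl⟩ := exists_centered_residue h1.minor_pos (a * r - s * t)
  have h2 := h1.add_two_to_three l
  have hl' : a * r - s * t + l * (a * b - t ^ 2) = a * (r + l * b) - (s + l * t) * t := by ring
  rw [hl'] at hl
  generalize c + 2 * l * r + l ^ 2 * b = c at *
  generalize r + l * b = r at *
  generalize s + l * t = s at *
  obtain ⟨m, hm⟩ := exists_centered_residue h2.pos s
  have h3 := h2.add_one_to_three m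
  have hm' : a * r - s * t = a * (r + m * t) - (s + m * a) * t := by ring
  rw [hm'] at hl
  exact ⟨_, _, _, _, _, _, h3, hmin _ _ _ _ _ _ h3.swap_one_two, hk, hm, hl,
    hmin' _ _ _ _ _ h3.swap_two_three⟩

lemma IsDetTenForm.exists_eq {N a b c r s t : ℤ} (h : IsDetTenForm N a b c r s t) :
    ∃ x y z : ℤ, x ^ 2 + 2 * y ^ 2 + 5 * z ^ 2 = N := by
  obtain ⟨a, b, c, r, s, t, h, hab, ⟨ht1, ht2⟩, ⟨hs1, hs2⟩, ⟨hr1, hr2⟩, hG⟩ := h.exists_reduced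
  have hpos := h.pos
  have hmul := h.minor_mul
  have hGpos := h.minor_pos
  have hG2 : 3 * (a * b - t ^ 2) ^ 2 ≤ 40 * a := by nlinarith
  have ht : 4 * t ^ 2 ≤ a ^ 2 := by nlinarith
  have hG1 : 3 * a ^ 2 ≤ 4 * (a * b - t ^ 2) := by nlinarith
  have ha : a ≤ 2 := by
    by_contra! ha
    have h4 : 9 * (a ^ 2) ^ 2 ≤ 16 * (a * b - t ^ 2) ^ 2 := by nlinarith [sq_nonneg a]
    have h5 : 27 ≤ a ^ 3 := by nlinarith [sq_nonneg (a - 3)]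
    nlinarith
  have hG5 : a * b - t ^ 2 ≤ 5 := by nlinarith
  have hodd := h.odd
  have hdet := h.det
  have e1 := h.aniso 1 2 0
  have e2 := h.aniso 0 1 2
  have e3 := h.aniso 1 0 2
  have e4 := h.aniso 0 1 (-2)
  have e5 := h.aniso 1 0 (-2)
  obtain ⟨x, y, z, hN⟩ := h.rep
  simp only [ternaryForm] at e1 e2 e3 e4 e5 hN
  clear h hG2 ht hG1 hmul
  have hb : b ≤ 5 := by nlinarith
  interval_cases a
  · obtain rfl : t = 0 := by omega
    obtain rfl : s = 0 := by omega
    interval_cases b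
    all_goals
      have hr3 : -2 ≤ r := by omega
      have hr4 : r ≤ 2 := by omega
      interval_cases r <;> try omega
    obtain rfl : c = 5 := by omega
    exact ⟨x, y, z, by linarith⟩
  · have ht3 : -1 ≤ t := by omega
    have ht4 : t ≤ 1 := by omega
    have hs3 : -1 ≤ s := by omega
    have hs4 : s ≤ 1 := by omega
    exfalso
    interval_cases b <;> interval_cases t <;> interval_cases s <;>
      first
      | omega
      | (have hr3 : -2 ≤ r := by omega
         have hr4 : r ≤ 2 := by omega
         interval_cases r <;> omega)

lemma five_dvd_of_binary {a b c n d x y : ℤ} (hd : a * c - b ^ 2 = d) (hnd : n * d % 5 = 2)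
    (hn : n % 5 = 1 ∨ n % 5 = 4) (h : 5 ∣ c * x ^ 2 + 2 * b * x * y + a * y ^ 2) :
    5 ∣ x ∧ 5 ∣ y := by
  have hd5 : d % 5 = 2 ∨ d % 5 = 3 := by
    rw [Int.mul_emod] at hnd
    rcases hn with hn | hn <;> rw [hn] at hnd <;> omega
  have key : ∀ a b c x y : ZMod 5, (a * c - b ^ 2 = 2 ∨ a * c - b ^ 2 = 3) →
      c * x ^ 2 + 2 * b * x * y + a * y ^ 2 = 0 → x = 0 ∧ y = 0 := by
    decide +kernel
  have h1 := key a b c x y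
    (by
      have hdz : ((a * c - b ^ 2 : ℤ) : ZMod 5) = (d : ZMod 5) := by rw [hd]
      push_cast at hdz
      rw [hdz]
      rcases hd5 with h5 | h5
      · left
        exact_mod_cast (ZMod.intCast_eq_intCast_iff d 2 5).2 h5
      · right
        exact_mod_cast (ZMod.intCast_eq_intCast_iff d 3 5).2 h5)
    (by exact_mod_cast (ZMod.intCast_zmod_eq_zero_iff_dvd _ 5).2 h)
  exact ⟨(ZMod.intCast_zmod_eq_zero_iff_dvd _ 5).1 h1.1,
    (ZMod.intCast_zmod_eq_zero_iff_dvd _ 5).1 h1.2⟩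

lemma exists_eq_of_binary {a b c n d τ : ℤ} (hc : 0 < c) (hd : 0 < d) (hdet : a * c - b ^ 2 = d)
    (hnd : n * d = 5 * τ ^ 2 * c + 2) (hn : n % 5 = 1 ∨ n % 5 = 4)
    (hodd : c % 2 = 1 ∨ a % 2 = 1 ∨ n % 2 = 1) :
    ∃ x y z : ℤ, x ^ 2 + 5 * y ^ 2 + 10 * z ^ 2 = n := by
  have h : IsDetTenForm (5 * n) c a (5 * n) (5 * τ) 0 b := {
    pos := hc
    minor_pos := by linarith [mul_comm a c]
    det := by linear_combination 5 * n * hdet + 5 * hnd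
    odd := by omega
    aniso := fun x y z hxyz => by
      simp only [ternaryForm] at hxyz
      have h1 : 5 ∣ c * x ^ 2 + 2 * b * x * y + a * y ^ 2 := by
        have h2 : c * x ^ 2 + 2 * b * x * y + a * y ^ 2 =
            (c * x ^ 2 + a * y ^ 2 + 5 * n * z ^ 2 + 2 * (5 * τ) * y * z + 2 * 0 * x * z +
              2 * b * x * y) - 5 * (n * z ^ 2 + 2 * τ * y * z) := by ring
        rw [h2]
        exact dvd_sub hxyz (dvd_mul_right _ _)
      obtain ⟨⟨x, rfl⟩, ⟨y, rfl⟩⟩ := five_dvd_of_binary hdet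
        (by rw [hnd, mul_assoc 5]; omega) hn h1
      exact ⟨⟨c * x + b * y, by ring⟩, ⟨b * x + a * y + τ * z, by ring⟩,
        ⟨5 * τ * y + n * z, by ring⟩⟩
    rep := ⟨0, 0, 1, by simp [ternaryForm]⟩ }
  obtain ⟨x, y, z, hxyz⟩ := h.exists_eq
  have key : ∀ x y : ZMod 5, x ^ 2 + 2 * y ^ 2 = 0 → x = 0 ∧ y = 0 := by decide
  have h1 := key x y (by
    have : ((x ^ 2 + 2 * y ^ 2 : ℤ) : ZMod 5) = 0 :=
      (ZMod.intCast_zmod_eq_zero_iff_dvd _ 5).2 ⟨n - z ^ 2, by push_cast; linarith⟩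
    exact_mod_cast this)
  obtain ⟨x, rfl⟩ := (ZMod.intCast_zmod_eq_zero_iff_dvd x 5).1 h1.1
  obtain ⟨y, rfl⟩ := (ZMod.intCast_zmod_eq_zero_iff_dvd y 5).1 h1.2
  exact ⟨z, x, y, by push_cast at hxyz; linarith⟩

lemma exists_prime_mul_eq {m k e : ℕ} (r : ℤ) (hm : Odd m) (hk : k.Coprime m) (he : e.Coprime m)
    (hr : Odd r) :
    ∃ p d : ℕ, p.Prime ∧ m * d = k * p + e ∧ (p : ℤ) % 8 = r % 8 ∧ 2 < p := by
  obtain ⟨u, v, huv⟩ := Nat.isCoprime_iff_coprime.2 hk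
  obtain ⟨s, t, hst⟩ : IsCoprime (8 : ℤ) m := by
    have : Nat.Coprime 8 m := (Nat.coprime_two_left.2 hm).pow_left 3
    exact_mod_cast Nat.isCoprime_iff_coprime.2 this
  have hu : IsCoprime u (m : ℤ) := ⟨k, v, by linarith⟩
  have hs : IsCoprime (8 * s) (m : ℤ) := ⟨1, t, by linarith⟩
  have htm : IsCoprime (t * m) (8 : ℤ) := ⟨1, s, by linarith⟩
  have hr8 : IsCoprime r (8 : ℤ) := by
    have h2 : IsCoprime r (2 : ℤ) := by
      obtain ⟨j, rfl⟩ := hr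
      exact ⟨1, -j, by ring⟩
    exact h2.pow_right (n := 3)
  have he' : IsCoprime (e : ℤ) m := Nat.isCoprime_iff_coprime.2 he
  have hcop : IsCoprime (-(e * u) * (8 * s) + r * (t * m)) ((m * 8 : ℕ) : ℤ) := by
    push_cast
    refine IsCoprime.mul_right ?_ ?_
    · have := ((he'.mul_left hu).neg_left.mul_left hs).add_mul_right_left (r * t)
      rwa [show -(e * u) * (8 * s) + r * t * m = -(e * u) * (8 * s) + r * (t * m) by ring] at this
    · have := (hr8.mul_left htm).add_mul_right_left (-(e * u) * s)
      rwa [show r * (t * m) + -(e * u) * s * 8 = -(e * u) * (8 * s) + r * (t * m) by ring] at this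
  have hm0 : m ≠ 0 := by rintro rfl; simp at hm
  obtain ⟨p, hp2, hp, hpa⟩ := Nat.forall_exists_prime_gt_and_zmodEq 2 (by positivity) hcop
  obtain ⟨w, hw⟩ := hpa.symm.dvd
  push_cast at hw
  have hdvd : (m : ℤ) ∣ ((k * p + e : ℕ) : ℤ) := by
    refine ⟨k * 8 * w + k * r * t + e * v + e * u * k * t, ?_⟩
    push_cast
    linear_combination k * hw - e * huv - e * u * k * hst
  obtain ⟨d, hd⟩ := Int.natCast_dvd_natCast.1 hdvd
  refine ⟨p, d, hp, hd.symm, ?_, hp2⟩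
  refine Int.emod_eq_emod_iff_emod_sub_eq_zero.2 (Int.emod_eq_zero_of_dvd ?_)
  exact ⟨m * w - (e * u) * s - r * s, by linear_combination hw + r * hst⟩

open NumberTheorySymbols in
lemma exists_mul_eq_sq_add {p : ℕ} (hp : p.Prime) {d : ℤ} (h : J(-d | p) = 1) :
    ∃ a b : ℤ, a * p - b ^ 2 = d := by
  have := Fact.mk hp
  obtain ⟨b, hb⟩ := ZMod.isSquare_of_jacobiSym_eq_one h
  obtain ⟨b, rfl⟩ := ZMod.intCast_surjective b
  have h1 : ((d + b * b : ℤ) : ZMod p) = 0 := by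
    push_cast
    rw [← hb]
    push_cast
    ring
  obtain ⟨a, ha⟩ := (ZMod.intCast_zmod_eq_zero_iff_dvd _ p).1 h1
  exact ⟨a, b, by linear_combination -ha⟩

open NumberTheorySymbols in
lemma jacobiSym_mul_of_mul_eq {m d k p e : ℕ} (h : m * d = k * p + e) :
    J(m | p) * J(-d | p) = J(-e | p) ∧ J(k | m) * J(p | m) = J(-e | m) := by
  have h' : (m * d : ℤ) = k * p + e := by exact_mod_cast h
  constructor
  · rw [← jacobiSym.mul_left]
    refine jacobiSym.mod_left' (Int.modEq_iff_dvd.2 ⟨k, ?_⟩)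
    linear_combination h'
  · rw [← jacobiSym.mul_left]
    refine jacobiSym.mod_left' (Int.modEq_iff_dvd.2 ⟨-d, ?_⟩)
    linear_combination h'

open NumberTheorySymbols in
lemma jacobiSym_five_left {m : ℕ} (hm : Odd m) : J(5 | m) = J((m % 5 : ℤ) | 5) := by
  have := jacobiSym.quadratic_reciprocity_one_mod_four (a := 5) (by norm_num) hm
  rw [← jacobiSym.mod_left' (Int.emod_emod_of_dvd (m : ℤ) (dvd_refl 5)).symm]
  exact_mod_cast this

lemma coprime_five {m : ℕ} (h : m % 5 ≠ 0) : Nat.Coprime 5 m :=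
  (Nat.Prime.coprime_iff_not_dvd (by norm_num)).2 (by omega)

open NumberTheorySymbols in
lemma exists_ternary_of_odd {n : ℕ} (hn : Odd n) (h5 : n % 5 = 1 ∨ n % 5 = 4) :
    ∃ x y z : ℤ, x ^ 2 + 5 * y ^ 2 + 10 * z ^ 2 = n := by
  have hn2 : Nat.Coprime 2 n := Nat.coprime_two_left.2 hn
  have hJ : J(-2 | n) = 1 ∨ J(-2 | n) = -1 :=
    jacobiSym.eq_one_or_neg_one hn2
  have h5n : J(5 | n) = 1 := by
    rw [jacobiSym_five_left hn]
    rcases h5 with h | h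
    · rw [show (n % 5 : ℤ) = 1 by omega]; norm_num
    · rw [show (n % 5 : ℤ) = 4 by omega]; norm_num
  obtain ⟨p, d, hp, hd, hp4, hpJ, hp2⟩ : ∃ p d : ℕ, p.Prime ∧ n * d = 5 * p + 2 ∧ p % 4 = 1 ∧
      J(-2 | p) = J(-2 | n) ∧ 2 < p := by
    rcases hJ with hJ | hJ
    · obtain ⟨p, d, hp, hd, hp8, hp2⟩ := exists_prime_mul_eq (k := 5) (e := 2) 1 hn
        (coprime_five (by omega)) hn2 (by decide)
      refine ⟨p, d, hp, hd, by omega, ?_, hp2⟩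
      rw [hJ, jacobiSym.at_neg_two (Nat.odd_iff.2 (by omega)), ZMod.χ₈'_nat_eq_if_mod_eight,
        if_neg (by omega), if_pos (by omega)]
    · obtain ⟨p, d, hp, hd, hp8, hp2⟩ := exists_prime_mul_eq (k := 5) (e := 2) 5 hn
        (coprime_five (by omega)) hn2 (by decide)
      refine ⟨p, d, hp, hd, by omega, ?_, hp2⟩
      rw [hJ, jacobiSym.at_neg_two (Nat.odd_iff.2 (by omega)), ZMod.χ₈'_nat_eq_if_mod_eight,
        if_neg (by omega), if_neg (by omega)]
  obtain ⟨h1, h2⟩ := jacobiSym_mul_of_mul_eq hd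
  push_cast at h1 h2
  rw [h5n, one_mul, jacobiSym.quadratic_reciprocity_one_mod_four hp4 hn] at h2
  rw [h2, hpJ] at h1
  obtain ⟨a, b, hab⟩ := exists_mul_eq_sq_add hp (d := d)
    (by rcases hJ with hJ | hJ <;> rw [hJ] at h1 <;> linarith)
  have hd' : (n * d : ℤ) = 5 * p + 2 := by exact_mod_cast hd
  have hd0 : 0 < d := by rcases Nat.eq_zero_or_pos d with rfl | h <;> omega
  exact exists_eq_of_binary (τ := 1) (by omega) (by omega) hab (by linarith) (by omega) (by omega)

open NumberTheorySymbols in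
lemma exists_ternary_of_two_mul_three_mod_four {m : ℕ} (hm : m % 4 = 3)
    (h5 : m % 5 = 2 ∨ m % 5 = 3) :
    ∃ x y z : ℤ, x ^ 2 + 5 * y ^ 2 + 10 * z ^ 2 = (2 * m : ℕ) := by
  have hodd : Odd m := Nat.odd_iff.2 (by omega)
  have h5m : J(5 | m) = -1 := by
    rw [jacobiSym_five_left hodd]
    rcases h5 with h | h
    · rw [show (m % 5 : ℤ) = 2 by omega]; norm_num
    · rw [show (m % 5 : ℤ) = 3 by omega]; norm_num
  obtain ⟨p, d, hp, hd, hp8, hp2⟩ := exists_prime_mul_eq (k := 5) (e := 1) 1 hodd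
    (coprime_five (by omega)) (Nat.coprime_one_left m) (by decide)
  have hpodd : Odd p := Nat.odd_iff.2 (by omega)
  obtain ⟨h1, h2⟩ := jacobiSym_mul_of_mul_eq hd
  push_cast at h1 h2
  rw [h5m, jacobiSym.at_neg_one hodd, ZMod.χ₄_nat_three_mod_four hm,
    jacobiSym.quadratic_reciprocity_one_mod_four (by omega) hodd] at h2
  rw [jacobiSym.at_neg_one hpodd, ZMod.χ₄_nat_one_mod_four (by omega)] at h1
  obtain ⟨a, b, hab⟩ := exists_mul_eq_sq_add hp (d := d) (by nlinarith)
  have hd' : (m * d : ℤ) = 5 * p + 1 := by exact_mod_cast hd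
  have hd0 : 0 < d := by rcases Nat.eq_zero_or_pos d with rfl | h <;> omega
  have hd4 : d % 4 = 2 := by
    have h4 : (m * d) % 4 = 2 := by omega
    rw [Nat.mul_mod, hm] at h4
    have := Nat.mod_lt d (show 4 > 0 by norm_num)
    interval_cases d % 4 <;> omega
  obtain ⟨a, b, hab, hb⟩ : ∃ a b : ℤ, a * p - b ^ 2 = d ∧ b % 2 = 0 := by
    rcases Int.emod_two_eq_zero_or_one b with hb | hb
    · exact ⟨a, b, hab, hb⟩
    · exact ⟨a + 2 * b + p, b + p, by linear_combination hab, by omega⟩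
  obtain ⟨b, rfl⟩ := Int.dvd_of_emod_eq_zero hb
  obtain ⟨j, hj⟩ : ∃ j : ℤ, (p : ℤ) = 4 * j + 1 := ⟨p / 4, by omega⟩
  have ha4 : a % 4 = 2 := by
    have h6 : a = d + 4 * (b ^ 2 - a * j) := by rw [hj] at hab; linear_combination hab
    omega
  obtain ⟨a, rfl⟩ : (2 : ℤ) ∣ a := by omega
  exact exists_eq_of_binary (a := a) (b := 2 * b) (c := 2 * p) (d := d) (τ := 1) (by omega)
    (by omega) (by linear_combination hab) (by push_cast; linear_combination 2 * hd') (by omega)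
    (by omega)

open NumberTheorySymbols in
lemma exists_ternary_of_two_mul_one_mod_four {m : ℕ} (hm : m % 4 = 1)
    (h5 : m % 5 = 2 ∨ m % 5 = 3) :
    ∃ x y z : ℤ, x ^ 2 + 5 * y ^ 2 + 10 * z ^ 2 = (2 * m : ℕ) := by
  have hodd : Odd m := Nat.odd_iff.2 (by omega)
  have h5m : J(5 | m) = -1 := by
    rw [jacobiSym_five_left hodd]
    rcases h5 with h | h
    · rw [show (m % 5 : ℤ) = 2 by omega]; norm_num
    · rw [show (m % 5 : ℤ) = 3 by omega]; norm_num
  have hm2 : Nat.Coprime 2 m := Nat.coprime_two_left.2 hodd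
  have hm10 : Nat.Coprime 10 m := Nat.Coprime.mul_left hm2 (coprime_five (by omega))
  have hJ : J(2 | m) = 1 ∨ J(2 | m) = -1 :=
    jacobiSym.eq_one_or_neg_one hm2
  obtain ⟨p, d, hp, hd, hpJ, hp2⟩ : ∃ p d : ℕ, p.Prime ∧ m * d = 10 * p + 1 ∧
      J(-1 | p) = -J(2 | m) ∧ 2 < p := by
    rcases hJ with hJ | hJ
    · obtain ⟨p, d, hp, hd, hp8, hp2⟩ := exists_prime_mul_eq (k := 10) (e := 1) 3 hodd
        hm10 (Nat.coprime_one_left m) (by decide)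
      refine ⟨p, d, hp, hd, ?_, hp2⟩
      rw [hJ, jacobiSym.at_neg_one (Nat.odd_iff.2 (by omega)),
        ZMod.χ₄_nat_three_mod_four (by omega)]
    · obtain ⟨p, d, hp, hd, hp8, hp2⟩ := exists_prime_mul_eq (k := 10) (e := 1) 1 hodd
        hm10 (Nat.coprime_one_left m) (by decide)
      refine ⟨p, d, hp, hd, ?_, hp2⟩
      rw [hJ, jacobiSym.at_neg_one (Nat.odd_iff.2 (by omega)),
        ZMod.χ₄_nat_one_mod_four (by omega), neg_neg]
  have hpodd : Odd p := hp.odd_of_ne_two (by omega)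
  obtain ⟨h1, h2⟩ := jacobiSym_mul_of_mul_eq hd
  push_cast at h1 h2
  rw [show (10 : ℤ) = 2 * 5 by norm_num, jacobiSym.mul_left, h5m, jacobiSym.at_neg_one hodd,
    ZMod.χ₄_nat_one_mod_four hm, ← jacobiSym.quadratic_reciprocity_one_mod_four hm hpodd] at h2
  rw [hpJ] at h1
  obtain ⟨a, b, hab⟩ := exists_mul_eq_sq_add hp (d := d)
    (by rcases hJ with hJ | hJ <;> rw [hJ] at h1 h2 <;> nlinarith)
  have hd' : (m * d : ℤ) = 10 * p + 1 := by exact_mod_cast hd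
  have hd0 : 0 < d := by rcases Nat.eq_zero_or_pos d with rfl | h <;> omega
  have := Nat.odd_iff.1 hpodd
  exact exists_eq_of_binary (τ := 2) (by omega) (by omega) hab
    (by push_cast; linear_combination 2 * hd') (by omega) (by omega)

/-- The form `x² + 5y² + 10z²` represents all positive integers congruent to `±1` modulo `5`. -/
theorem exists_sq_add_five_mul_sq_add_ten_mul_sq (n : ℕ) (h5 : n % 5 = 1 ∨ n % 5 = 4) :
    ∃ x y z : ℤ, x ^ 2 + 5 * y ^ 2 + 10 * z ^ 2 = n := by
  induction n using Nat.strong_induction_on with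
  | _ n ih =>
    rcases Nat.even_or_odd' n with ⟨m, rfl | rfl⟩
    · rcases Nat.even_or_odd' m with ⟨k, rfl | rfl⟩
      · obtain ⟨x, y, z, h⟩ := ih k (by omega) (by omega)
        exact ⟨2 * x, 2 * y, 2 * z, by push_cast; linear_combination 4 * h⟩
      · rcases Nat.even_or_odd' k with ⟨l, rfl | rfl⟩
        · exact exists_ternary_of_two_mul_one_mod_four (by omega) (by omega)
        · exact exists_ternary_of_two_mul_three_mod_four (by omega) (by omega)
    · exact exists_ternary_of_odd ⟨m, rfl⟩ h5

/-- The form `x² + 2y² + 5z² + 10w²` is universal. -/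
theorem exists_sq_add_two_mul_sq_add_five_mul_sq_add_ten_mul_sq (n : ℕ) :
    ∃ x y z w : ℤ, x ^ 2 + 2 * y ^ 2 + 5 * z ^ 2 + 10 * w ^ 2 = n := by
  induction n using Nat.strong_induction_on with
  | _ n ih =>
    have of_five_mul (k : ℕ) (w : ℤ) (hk : k % 5 = 1 ∨ k % 5 = 4)
        (h : (n : ℤ) = 5 * k + 10 * w ^ 2) :
        ∃ x y z w : ℤ, x ^ 2 + 2 * y ^ 2 + 5 * z ^ 2 + 10 * w ^ 2 = n := by
      obtain ⟨x, y, z, hk⟩ := exists_sq_add_five_mul_sq_add_ten_mul_sq k hk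
      exact ⟨5 * y, 5 * z, x, w, by linear_combination 5 * hk - h⟩
    have of_add_two_mul (k : ℕ) (y : ℤ) (hk : k % 5 = 1 ∨ k % 5 = 4)
        (h : (n : ℤ) = k + 2 * y ^ 2) :
        ∃ x y z w : ℤ, x ^ 2 + 2 * y ^ 2 + 5 * z ^ 2 + 10 * w ^ 2 = n := by
      obtain ⟨x, z, w, hk⟩ := exists_sq_add_five_mul_sq_add_ten_mul_sq k hk
      exact ⟨x, y, z, w, by linear_combination hk - h⟩
    rcases Nat.eq_zero_or_pos n with rfl | hn
    · exact ⟨0, 0, 0, 0, by norm_num⟩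
    by_cases h25 : n % 25 = 0
    · obtain ⟨m, rfl⟩ := Nat.dvd_of_mod_eq_zero h25
      obtain ⟨x, y, z, w, h⟩ := ih m (by omega)
      exact ⟨5 * x, 5 * y, 5 * z, 5 * w, by push_cast; linear_combination 25 * h⟩
    by_cases h0 : n % 5 = 0
    · obtain ⟨k, rfl⟩ := Nat.dvd_of_mod_eq_zero h0
      have hk : k % 5 = 1 ∨ k % 5 = 4 ∨ k % 5 = 3 ∨ k = 2 ∨ k = 7 ∨ (k % 5 = 2 ∧ 8 ≤ k) := by
        omega
      rcases hk with hk | hk | hk | rfl | rfl | ⟨hk, hk8⟩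
      · exact of_five_mul k 0 (Or.inl hk) (by push_cast; ring)
      · exact of_five_mul k 0 (Or.inr hk) (by push_cast; ring)
      · exact of_five_mul (k - 2) 1 (by omega) (by omega)
      · exact ⟨0, 0, 0, 1, by norm_num⟩
      · exact ⟨5, 0, 0, 1, by norm_num⟩
      · exact of_five_mul (k - 8) 2 (by omega) (by omega)
    · have hn' : n % 5 = 1 ∨ n % 5 = 4 ∨ n % 5 = 3 ∨ n = 2 ∨ n = 7 ∨ (n % 5 = 2 ∧ 8 ≤ n) := by
        omega
      rcases hn' with hk | hk | hk | rfl | rfl | ⟨hk, hk8⟩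
      · exact of_add_two_mul n 0 (Or.inl hk) (by ring)
      · exact of_add_two_mul n 0 (Or.inr hk) (by ring)
      · exact of_add_two_mul (n - 2) 1 (by omega) (by omega)
      · exact ⟨0, 1, 0, 0, by norm_num⟩
      · exact ⟨0, 1, 1, 0, by norm_num⟩
      · exact of_add_two_mul (n - 8) 2 (by omega) (by omega)

theorem stmt_18 (n : ℤ) (hn : 0 ≤ n) :
    (∃ x1 x2 y1 y2 : ℤ, x1^2 + 10*x2^2 + 5*y1^2 + 50*y2^2 = n) ↔
    (n % 5 = 0 ∨ n % 5 = 1 ∨ n % 5 = 4) := by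
  constructor
  · rintro ⟨x, x₂, y₁, y₂, rfl⟩
    have hx : x ^ 2 % 5 = 0 ∨ x ^ 2 % 5 = 1 ∨ x ^ 2 % 5 = 4 := by
      have h5 : x % 5 = 0 ∨ x % 5 = 1 ∨ x % 5 = 2 ∨ x % 5 = 3 ∨ x % 5 = 4 := by omega
      rcases h5 with h | h | h | h | h <;> simp [pow_two, Int.mul_emod, h]
    omega
  · lift n to ℕ using hn
    rintro (h | h)
    · obtain ⟨k, rfl⟩ : 5 ∣ n := by omega
      obtain ⟨x, y, z, w, h⟩ := exists_sq_add_two_mul_sq_add_five_mul_sq_add_ten_mul_sq k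
      exact ⟨5 * z, y, x, w, by push_cast; linear_combination 5 * h⟩
    · obtain ⟨x, y, z, h⟩ := exists_sq_add_five_mul_sq_add_ten_mul_sq n (by omega)
      exact ⟨x, z, y, 0, by linear_combination h⟩
end

section
/- A nonnegative integer n is represented by the quaternary quadratic form x₁² + x₁x₂ + 3x₂² + 11y₁² + 11y₁y₂ + 33y₂² if and only if n ≡ 0, 1, 3, 4, 5 or 9 (mod 11). (This is the regularity of the binary Hermitian lattice ⟨1,11⟩ over ℚ(√-11), stated for its associated quadratic form.) -/
/-- The norm form of `ℤ[ω]`, `ω = (1 + √-11) / 2`, at `x₁ + x₂ω`. -/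
def nrm (x₁ x₂ : ℤ) : ℤ := x₁ ^ 2 + x₁ * x₂ + 3 * x₂ ^ 2

/-- The binary Hermitian form `a|x|² + tr(b x ȳ) + c|y|²` over `ℤ[ω]`. -/
def herm (a b₁ b₂ c x₁ x₂ y₁ y₂ : ℤ) : ℤ :=
  a * nrm x₁ x₂ + c * nrm y₁ y₂ + (2 * (b₁ * x₁ - 3 * b₂ * x₂) * y₁ + (b₁ * x₁ - 3 * b₂ * x₂) * y₂
    + (b₁ * x₂ + b₂ * x₁ + b₂ * x₂) * y₁ + 6 * (b₁ * x₂ + b₂ * x₁ + b₂ * x₂) * y₂)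

/-- `n` is a value of the Hermitian form with coefficients `a`, `b₁ + b₂ω`, `c`. -/
def HRep (a b₁ b₂ c n : ℤ) : Prop := ∃ x₁ x₂ y₁ y₂, herm a b₁ b₂ c x₁ x₂ y₁ y₂ = n

lemma HRep.mul {c m n : ℤ} (hm : HRep 1 0 0 c m) (hn : HRep 1 0 0 c n) :
    HRep 1 0 0 c (m * n) := by
  obtain ⟨x₁, x₂, y₁, y₂, rfl⟩ := hm
  obtain ⟨u₁, u₂, v₁, v₂, rfl⟩ := hn
  refine ⟨x₁ * u₁ - 3 * x₂ * u₂ - c * (y₁ * (v₁ + v₂) + 3 * y₂ * v₂),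
    x₁ * u₂ + x₂ * u₁ + x₂ * u₂ - c * (y₂ * v₁ - y₁ * v₂),
    x₁ * v₁ - 3 * x₂ * v₂ + y₁ * (u₁ + u₂) + 3 * y₂ * u₂,
    x₁ * v₂ + x₂ * v₁ + x₂ * v₂ + y₂ * u₁ - y₁ * u₂, ?_⟩
  simp only [herm, nrm]
  ring

lemma HRep.translate {a b₁ b₂ c n : ℤ} (r₁ r₂ : ℤ) (h : HRep a b₁ b₂ c n) :
    HRep a (b₁ + a * r₁) (b₂ + a * r₂)
      (c + a * nrm r₁ r₂ + (2 * b₁ * r₁ + b₁ * r₂ + b₂ * r₁ + 6 * b₂ * r₂)) n := by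
  obtain ⟨x₁, x₂, y₁, y₂, rfl⟩ := h
  refine ⟨x₁ - ((r₁ + r₂) * y₁ + 3 * r₂ * y₂), x₂ - (r₁ * y₂ - r₂ * y₁), y₁, y₂, ?_⟩
  simp only [herm, nrm]
  ring

lemma HRep.swap {a b₁ b₂ c n : ℤ} (h : HRep a b₁ b₂ c n) : HRep c (b₁ + b₂) (-b₂) a n := by
  obtain ⟨x₁, x₂, y₁, y₂, rfl⟩ := h
  refine ⟨y₁, y₂, x₁, x₂, ?_⟩
  simp only [herm, nrm]
  ring

lemma HRep.neg {a b₁ b₂ c n : ℤ} (h : HRep a b₁ b₂ c n) : HRep a (-b₁) (-b₂) c n := by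
  obtain ⟨x₁, x₂, y₁, y₂, rfl⟩ := h
  refine ⟨-x₁, -x₂, y₁, y₂, ?_⟩
  simp only [herm, nrm]
  ring

lemma hrep_translate_iff {a b₁ b₂ c : ℤ} (r₁ r₂ n : ℤ) : HRep a b₁ b₂ c n ↔
    HRep a (b₁ + a * r₁) (b₂ + a * r₂)
      (c + a * nrm r₁ r₂ + (2 * b₁ * r₁ + b₁ * r₂ + b₂ * r₁ + 6 * b₂ * r₂)) n := by
  refine ⟨HRep.translate r₁ r₂, fun h => ?_⟩
  have := h.translate (-r₁) (-r₂)
  simp only [nrm] at this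
  convert this using 1 <;> ring

lemma hrep_swap_iff {a b₁ b₂ c n : ℤ} : HRep a b₁ b₂ c n ↔ HRep c (b₁ + b₂) (-b₂) a n :=
  ⟨HRep.swap, fun h => by simpa using h.swap⟩

lemma hrep_neg_iff {a b₁ b₂ c n : ℤ} : HRep a b₁ b₂ c n ↔ HRep a (-b₁) (-b₂) c n :=
  ⟨HRep.neg, fun h => by simpa using h.neg⟩

lemma exists_abs_two_mul_add_mul_le {a : ℤ} (ha : 0 < a) (b : ℤ) : ∃ r, |2 * (b + a * r)| ≤ a := by
  refine ⟨-((2 * b + a) / (2 * a)), ?_⟩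
  have h1 := Int.emod_add_mul_ediv (2 * b + a) (2 * a)
  have h2 := Int.emod_nonneg (2 * b + a) (show 2 * a ≠ 0 by omega)
  have h3 := Int.emod_lt_of_pos (2 * b + a) (show 0 < 2 * a by omega)
  rw [abs_le]
  constructor <;> linarith

/-- Every positive unimodular binary Hermitian form over `ℤ[ω]` has the same values as `⟨1, 1⟩` or
as the form `2|x|² + tr(ω x ȳ) + 2|y|²`. -/
theorem hrep_of_det_eq_one {a b₁ b₂ c : ℤ} (ha : 0 < a) (hdet : a * c - nrm b₁ b₂ = 1) :
    (∀ n, HRep a b₁ b₂ c n ↔ HRep 1 0 0 1 n) ∨ (∀ n, HRep a b₁ b₂ c n ↔ HRep 2 0 1 2 n) := by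
  induction hk : a.toNat using Nat.strong_induction_on generalizing a b₁ b₂ c with
  | _ k ih =>
    subst hk
    obtain ⟨r₂, hr₂⟩ := exists_abs_two_mul_add_mul_le ha b₂
    obtain ⟨r₁, hr₁⟩ := exists_abs_two_mul_add_mul_le (a := 2 * a) (by omega)
      (2 * b₁ + (b₂ + a * r₂))
    have hB : ∃ B₁ B₂ C, |2 * B₂| ≤ a ∧ |2 * B₁ + B₂| ≤ a ∧ a * C - nrm B₁ B₂ = 1 ∧
        ∀ n, HRep a b₁ b₂ c n ↔ HRep a B₁ B₂ C n := by
      refine ⟨_, _, _, hr₂, ?_, ?_, fun n => hrep_translate_iff r₁ r₂ n⟩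
      · rw [abs_le] at hr₁ ⊢
        constructor <;> linarith
      · rw [← hdet]
        simp only [nrm]
        ring
    clear hr₁ hr₂ r₁ r₂ hdet
    obtain ⟨B₁, B₂, C, h₂, h₁, hdet, hiff⟩ := hB
    simp only [hiff]
    clear hiff
    have hn0 : 0 ≤ nrm B₁ B₂ := by
      simp only [nrm]; nlinarith [sq_nonneg (2 * B₁ + B₂), sq_nonneg B₂]
    have hC : 0 < C := by nlinarith
    rcases lt_or_ge C a with hlt | hge
    · have := ih C.toNat (by omega) hC (b₁ := B₁ + B₂) (b₂ := -B₂) (c := a)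
        (by rw [← hdet]; simp only [nrm]; ring) rfl
      simpa only [hrep_swap_iff (a := a) (b₁ := B₁)] using this
    have hs2 : (2 * B₂) ^ 2 ≤ a ^ 2 := sq_le_sq' (by linarith [abs_le.1 h₂]) (abs_le.1 h₂).2
    have hs1 : (2 * B₁ + B₂) ^ 2 ≤ a ^ 2 := sq_le_sq' (by linarith [abs_le.1 h₁]) (abs_le.1 h₁).2
    have hn : 16 * nrm B₁ B₂ ≤ 15 * a ^ 2 := by simp only [nrm]; linarith
    have ha4 : a ≤ 4 := by nlinarith
    rw [abs_le] at h₁ h₂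
    have hb2 : -2 ≤ B₂ := by omega
    have hb2' : B₂ ≤ 2 := by omega
    have hb1 : -3 ≤ B₁ := by omega
    have hb1' : B₁ ≤ 3 := by omega
    have key : (a = 1 ∧ B₁ = 0 ∧ B₂ = 0 ∧ C = 1) ∨ (a = 2 ∧ C = 2 ∧
        (B₁ = 0 ∧ B₂ = 1 ∨ B₁ = 0 ∧ B₂ = -1 ∨ B₁ = 1 ∧ B₂ = -1 ∨ B₁ = -1 ∧ B₂ = 1)) ∨
        (a = 4 ∧ C = 4 ∧ (B₁ = 1 ∧ B₂ = 2 ∨ B₁ = -3 ∧ B₂ = 2 ∨ B₁ = 3 ∧ B₂ = -2 ∨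
          B₁ = -1 ∧ B₂ = -2)) := by
      simp only [nrm] at hdet hn
      clear ih hs1 hs2 hn0
      interval_cases a <;> interval_cases B₂ <;> interval_cases B₁ <;> omega
    have hfour : ∀ {B₁ B₂ : ℤ} (r₁ r₂ : ℤ), a = 4 → nrm (B₁ + 4 * r₁) (B₂ + 4 * r₂) = 11 →
        4 + 4 * nrm r₁ r₂ + (2 * B₁ * r₁ + B₁ * r₂ + B₂ * r₁ + 6 * B₂ * r₂) = 3 →
        (∀ n, HRep 4 B₁ B₂ 4 n ↔ HRep 1 0 0 1 n) ∨ ∀ n, HRep 4 B₁ B₂ 4 n ↔ HRep 2 0 1 2 n := by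
      intro B₁ B₂ r₁ r₂ ha h11 h3
      simp only [hrep_translate_iff (a := 4) (b₁ := B₁) r₁ r₂, h3]
      simp only [hrep_swap_iff (a := 4) (c := 3)]
      refine ih 3 (by omega) (by norm_num) ?_ rfl
      simp only [nrm] at h11 ⊢
      linarith
    rcases key with ⟨rfl, rfl, rfl, rfl⟩ | ⟨rfl, rfl, h⟩ | ⟨rfl, rfl, h⟩
    · exact .inl fun n => Iff.rfl
    · right
      intro n
      rcases h with ⟨rfl, rfl⟩ | ⟨rfl, rfl⟩ | ⟨rfl, rfl⟩ | ⟨rfl, rfl⟩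
      · rfl
      · rw [hrep_neg_iff]; norm_num
      · rw [hrep_swap_iff]; norm_num
      · rw [hrep_neg_iff, hrep_swap_iff]; norm_num
    · rcases h with ⟨rfl, rfl⟩ | ⟨rfl, rfl⟩ | ⟨rfl, rfl⟩ | ⟨rfl, rfl⟩
      · exact hfour 0 (-1) rfl (by norm_num [nrm]) (by norm_num [nrm])
      · exact hfour 1 (-1) rfl (by norm_num [nrm]) (by norm_num [nrm])
      · exact hfour (-1) 1 rfl (by norm_num [nrm]) (by norm_num [nrm])
      · exact hfour 0 1 rfl (by norm_num [nrm]) (by norm_num [nrm])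

/-- An isometry of order three of the indecomposable unimodular form. -/
lemma herm_rotate (x₁ x₂ y₁ y₂ : ℤ) : herm 2 0 1 2 (-2 * x₁ - y₁ - 3 * y₂) (-2 * x₂ + y₁)
    (-3 * x₂ + y₁) (x₁ + x₂ + y₂) = herm 2 0 1 2 x₁ x₂ y₁ y₂ := by
  simp only [herm, nrm]
  ring

/-- The values of the indecomposable unimodular form are values of `⟨1, 1⟩`. -/
lemma HRep.of_indecomposable {n : ℤ} (h : HRep 2 0 1 2 n) : HRep 1 0 0 1 n := by
  have base : ∀ x₁ x₂ y₁ y₂ : ℤ, 2 ∣ y₁ - y₂ → HRep 1 0 0 1 (herm 2 0 1 2 x₁ x₂ y₁ y₂) := by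
    rintro x₁ x₂ y₁ y₂ ⟨k, hk⟩
    obtain rfl : y₁ = y₂ + 2 * k := by omega
    refine ⟨x₁ + 3 * y₂ + 2 * k, x₂ - y₂ - k, x₁ + y₂, x₂ - k, ?_⟩
    simp only [herm, nrm]
    ring
  obtain ⟨x₁, x₂, y₁, y₂, rfl⟩ := h
  rcases Int.even_or_odd' (y₁ - y₂) with ⟨k, hk | hk⟩
  · exact base _ _ _ _ ⟨k, hk⟩
  · rw [← herm_rotate]
    rcases Int.even_or_odd' x₁ with ⟨l, hl | hl⟩
    · rw [← herm_rotate]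
      exact base _ _ _ _ (by omega)
    · exact base _ _ _ _ (by omega)

/-- An auxiliary ternary form: the norm form of trace-zero elements of `ℤ⟨√-11, i⟩`. -/
def tern (b c d : ℤ) : ℤ := b ^ 2 + 11 * c ^ 2 + 11 * d ^ 2

/-- `n` is a value of `tern` at a vector with odd first coordinate whose other coordinates are not
both even. -/
def TernOddRep (n : ℤ) : Prop := ∃ b c d, b % 2 = 1 ∧ (c % 2 = 1 ∨ d % 2 = 1) ∧ tern b c d = n

lemma ternOddRep_of_four_dvd {b c d : ℤ} (h4 : 4 ∣ tern b c d)
    (h : b % 2 = 1 ∨ c % 2 = 1 ∨ d % 2 = 1) : TernOddRep (tern b c d) := by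
  refine ⟨b, c, d, ?_⟩
  simp only [and_true]
  obtain ⟨k, hk⟩ := h4
  rcases Int.even_or_odd' b with ⟨x, rfl | rfl⟩ <;> rcases Int.even_or_odd' c with ⟨y, rfl | rfl⟩ <;>
    rcases Int.even_or_odd' d with ⟨z, rfl | rfl⟩ <;> simp only [tern] at hk <;> ring_nf at hk <;>
    omega

lemma tern_rotate (b c d : ℤ) : tern (3 * b - 22 * c + 11 * d) (-2 * b - 4 * c - 2 * d)
    (-b + 2 * c + 7 * d) = 64 * tern b c d := by
  simp only [tern]; ring

lemma tern_swap (b c d : ℤ) : tern b d c = tern b c d := by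
  simp only [tern]; ring

lemma ternOddRep_four_or_sixteen_of_odd {b c d : ℤ} (hb : b % 2 = 1) (hd : d % 2 = 1) :
    TernOddRep (4 * tern b c d) ∨ TernOddRep (16 * tern b c d) := by
  have main : ∀ d : ℤ, d % 2 = 1 → ¬ (8 ∣ 3 * b - 22 * c + 11 * d) →
      TernOddRep (4 * tern b c d) ∨ TernOddRep (16 * tern b c d) := by
    intro d hd h8
    have hrot := tern_rotate b c d
    obtain ⟨r, hr⟩ : 2 ∣ 3 * b - 22 * c + 11 * d := by omega
    obtain ⟨s, hs⟩ : 2 ∣ -2 * b - 4 * c - 2 * d := by omega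
    obtain ⟨t, ht⟩ : 2 ∣ -b + 2 * c + 7 * d := by omega
    rw [hr, hs, ht] at hrot
    have h16 : tern r s t = 16 * tern b c d := by
      simp only [tern] at hrot ⊢; linarith
    by_cases hodd : r % 2 = 1 ∨ s % 2 = 1 ∨ t % 2 = 1
    · right
      rw [← h16]
      exact ternOddRep_of_four_dvd (by omega) hodd
    · left
      obtain ⟨r, rfl⟩ : 2 ∣ r := by omega
      obtain ⟨s, rfl⟩ : 2 ∣ s := by omega
      obtain ⟨t, rfl⟩ : 2 ∣ t := by omega
      have h4 : tern r s t = 4 * tern b c d := by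
        simp only [tern] at h16 ⊢; linarith
      rw [← h4]
      exact ternOddRep_of_four_dvd (by omega) (by omega)
  by_cases h8 : 8 ∣ 3 * b - 22 * c + 11 * d
  · have := main (-d) (by omega) (by omega)
    simpa [tern] using this
  · exact main d hd h8

lemma TernOddRep.four_or_sixteen {n : ℤ} (h : TernOddRep n) :
    TernOddRep (4 * n) ∨ TernOddRep (16 * n) := by
  obtain ⟨b, c, d, hb, hc | hd, rfl⟩ := h
  · rw [← tern_swap]
    exact ternOddRep_four_or_sixteen_of_odd hb hc
  · exact ternOddRep_four_or_sixteen_of_odd hb hd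

lemma TernOddRep.sixteen_or_sixtyFour {n : ℤ} (h : TernOddRep n) :
    TernOddRep (16 * n) ∨ TernOddRep (64 * n) := by
  rcases h.four_or_sixteen with h | h
  · have := h.four_or_sixteen
    ring_nf at this ⊢
    exact this
  · exact .inl h

lemma ternOddRep_sixteen_or_sixtyFour {b c d : ℤ} (h : b ≠ 0 ∨ c ≠ 0 ∨ d ≠ 0) :
    TernOddRep (16 * tern b c d) ∨ TernOddRep (64 * tern b c d) := by
  have main : ∀ {b c d : ℤ}, (b + d) % 2 = 1 → TernOddRep (64 * tern b c d) := by
    intro b c d hbd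
    rw [← tern_rotate]
    refine ternOddRep_of_four_dvd ?_ (by omega)
    rw [tern_rotate]
    omega
  induction hk : b.natAbs + c.natAbs + d.natAbs using Nat.strong_induction_on
    generalizing b c d with
  | _ k ih =>
    by_cases hd : (b + d) % 2 = 1
    · exact .inr (main hd)
    by_cases hc : (b + c) % 2 = 1
    · rw [← tern_swap]
      exact .inr (main hc)
    by_cases hb : b % 2 = 1
    · exact TernOddRep.sixteen_or_sixtyFour ⟨b, c, d, hb, by omega, rfl⟩
    obtain ⟨b, rfl⟩ : 2 ∣ b := by omega
    obtain ⟨c, rfl⟩ : 2 ∣ c := by omega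
    obtain ⟨d, rfl⟩ : 2 ∣ d := by omega
    have h4 : tern (2 * b) (2 * c) (2 * d) = 4 * tern b c d := by
      simp only [tern]; ring
    rw [h4]
    rcases ih _ (by omega) (b := b) (c := c) (d := d) (by omega) rfl with h | h
    · have := h.four_or_sixteen
      ring_nf at this ⊢
      exact this
    · left
      ring_nf at h ⊢
      exact h

lemma hrep_indecomposable_of_four_mul_eq {n A B C D : ℤ} (hn : n % 2 = 1) (hA : A % 2 = 0)
    (hB : B % 2 = 1) (hCD : C % 2 = 1 ∨ D % 2 = 1) (h : 4 * n = A ^ 2 + tern B C D) :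
    HRep 2 0 1 2 n := by
  wlog hD : D % 2 = 1 generalizing C D
  · exact this hCD.symm (by rw [h, tern_swap]) (hCD.resolve_right hD)
  have main : ∀ e c k d : ℤ, HRep 2 0 1 2 (nrm (2 * e) (2 * c) + nrm (2 * k) d) := by
    intro e c k d
    refine ⟨-2 * c - 2 * k + d, -c + e + k, 2 * k + 2 * e + d, 2 * c - d, ?_⟩
    simp only [herm, nrm]
    ring
  obtain ⟨a, rfl⟩ : ∃ a, A = 2 * a := ⟨A / 2, by omega⟩
  obtain ⟨m, rfl⟩ : ∃ m, n = 2 * m + 1 := ⟨n / 2, by omega⟩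
  obtain ⟨d, rfl⟩ : ∃ d, D = 2 * d + 1 := ⟨D / 2, by omega⟩
  obtain ⟨y, rfl⟩ : ∃ y, B = 2 * y + (2 * d + 1) := ⟨(B - (2 * d + 1)) / 2, by omega⟩
  have hC : C % 2 = 0 := by
    rcases Int.even_or_odd' C with ⟨x, rfl | rfl⟩
    · omega
    · simp only [tern] at h; ring_nf at h; omega
  obtain ⟨c, rfl⟩ : ∃ c, C = 2 * c := ⟨C / 2, by omega⟩
  have hac : (a - c) % 2 = 0 := by
    rcases Int.even_or_odd' a with ⟨x, rfl | rfl⟩ <;> rcases Int.even_or_odd' c with ⟨z, rfl | rfl⟩ <;>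
    rcases Int.even_or_odd' y with ⟨w, rfl | rfl⟩ <;> simp only [tern] at h <;> ring_nf at h <;>
    omega
  obtain ⟨e, rfl⟩ : ∃ e, a = c + 2 * e := ⟨(a - c) / 2, by omega⟩
  rcases Int.even_or_odd' y with ⟨k, rfl | rfl⟩
  · convert main e c k (2 * d + 1) using 1
    simp only [nrm, tern] at h ⊢
    linarith
  · convert main e c (k + d + 1) (-(2 * d + 1)) using 1
    simp only [nrm, tern] at h ⊢
    linarith

lemma hrep_indecomposable_or_sq {n a b c d : ℤ} (hn : n % 2 = 1) (h : n = a ^ 2 + tern b c d)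
    (ha : a % 2 = 1) (hv : b ≠ 0 ∨ c ≠ 0 ∨ d ≠ 0)
    (hpar : b % 2 = 1 ∧ (c % 2 = 1 ∨ d % 2 = 1) ∨ b % 2 = 0 ∧ c % 2 = 0 ∧ d % 2 = 0) :
    HRep 2 0 1 2 n ∨ HRep 2 0 1 2 (n ^ 2) := by
  have key : TernOddRep (4 * tern b c d) ∨ TernOddRep (16 * tern b c d) := by
    rcases hpar with ⟨hb, hcd⟩ | ⟨hb, hc, hd⟩
    · exact TernOddRep.four_or_sixteen ⟨b, c, d, hb, hcd, rfl⟩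
    · obtain ⟨b, rfl⟩ : 2 ∣ b := by omega
      obtain ⟨c, rfl⟩ : 2 ∣ c := by omega
      obtain ⟨d, rfl⟩ : 2 ∣ d := by omega
      have := ternOddRep_sixteen_or_sixtyFour (b := b) (c := c) (d := d) (by omega)
      have h4 : tern (2 * b) (2 * c) (2 * d) = 4 * tern b c d := by
        simp only [tern]; ring
      rw [h4]
      ring_nf at this ⊢
      exact this
  rcases key with ⟨B, C, D, hB, hCD, hT⟩ | ⟨B, C, D, hB, hCD, hT⟩
  · left
    refine hrep_indecomposable_of_four_mul_eq hn (A := 2 * a) (by omega) hB hCD ?_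
    rw [hT, h]
    ring
  · right
    have hodd : ∀ x : ℤ, (a * x) % 2 = x % 2 := fun x => by
      rw [Int.mul_emod, ha, one_mul, Int.emod_emod_of_dvd _ dvd_rfl]
    refine hrep_indecomposable_of_four_mul_eq (A := 2 * (a ^ 2 - tern b c d)) (B := a * B)
      (C := a * C) (D := a * D) ?_ (by omega) ?_ ?_ ?_
    · rw [pow_two, Int.mul_emod, hn]; rfl
    · rw [hodd, hB]
    · rwa [hodd, hodd]
    · have : tern (a * B) (a * C) (a * D) = a ^ 2 * tern B C D := by
        simp only [tern]; ring
      rw [this, hT, h]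
      ring

/-- An element of `ℤ[ω]` that vanishes modulo `√-11` is divisible by it. -/
lemma exists_sqrt_mul_of_cast_eq_zero {y₁ y₂ : ℤ} (h : (y₁ : ZMod 11) + 6 * y₂ = 0) :
    ∃ w₁ w₂, y₁ = -w₁ - 6 * w₂ ∧ y₂ = 2 * w₁ + w₂ := by
  have h' : ((y₁ + 6 * y₂ : ℤ) : ZMod 11) = 0 := by push_cast; exact h
  obtain ⟨k, hk⟩ := (ZMod.intCast_zmod_eq_zero_iff_dvd _ 11).1 h'
  push_cast at hk
  exact ⟨k, y₂ - 2 * k, by linarith, by ring⟩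

lemma HRep.indecomposable_of_eleven_mul {m : ℤ} (h : HRep 2 0 1 2 (11 * m)) :
    HRep 2 0 1 2 m := by
  have anis : ∀ z w : ZMod 11, z ^ 2 + w ^ 2 = 0 → z = 0 ∧ w = 0 := by decide
  have zero : (11 : ZMod 11) = 0 := rfl
  obtain ⟨x₁, x₂, y₁, y₂, h⟩ := h
  simp only [herm, nrm] at h
  have hc := congrArg (Int.cast : ℤ → ZMod 11) h
  push_cast at hc
  have hs := anis (2 * (x₁ + 6 * x₂) + 6 * (y₁ + 6 * y₂)) (y₁ + 6 * y₂) (by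
    linear_combination 2 * hc + (2 * (m : ZMod 11) + 12 * x₂ ^ 2 + 4 * x₁ * x₂ + 40 * y₁ * y₂
      + 120 * y₂ ^ 2 + 3 * y₁ ^ 2 + 2 * x₁ * y₁ + 14 * x₂ * y₁ + 12 * x₁ * y₂ + 78 * x₂ * y₂) * zero)
  obtain ⟨h₁, h₂⟩ := hs
  have hx : (x₁ : ZMod 11) + 6 * x₂ = 0 := by
    linear_combination 6 * h₁ - 36 * h₂ - (x₁ + 6 * x₂) * zero
  obtain ⟨u₁, u₂, rfl, rfl⟩ := exists_sqrt_mul_of_cast_eq_zero hx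
  obtain ⟨v₁, v₂, rfl, rfl⟩ := exists_sqrt_mul_of_cast_eq_zero h₂
  refine ⟨u₁, u₂, v₁, v₂, mul_left_cancel₀ (show (11 : ℤ) ≠ 0 by norm_num) ?_⟩
  rw [← h]
  simp only [herm, nrm]
  ring

lemma nrm_nonneg (x₁ x₂ : ℤ) : 0 ≤ nrm x₁ x₂ := by
  simp only [nrm]
  nlinarith [sq_nonneg (2 * x₁ + x₂), sq_nonneg x₂]

lemma herm_indecomposable_ne_one (x₁ x₂ y₁ y₂ : ℤ) : herm 2 0 1 2 x₁ x₂ y₁ y₂ ≠ 1 := by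
  intro h
  have hsum : nrm (2 * x₁ + y₁ + 3 * y₂) (2 * x₂ - y₁) + nrm y₁ y₂ = 2 := by
    simp only [herm, nrm] at h ⊢
    linarith
  have small : ∀ u v : ℤ, nrm u v ≤ 2 → v = 0 ∧ u ^ 2 ≤ 2 := by
    intro u v huv
    simp only [nrm] at huv
    have hv : v = 0 := by
      have : v ^ 2 < 1 := by nlinarith [sq_nonneg (2 * u + v)]
      simpa using this
    subst hv
    exact ⟨rfl, by linarith⟩
  obtain ⟨h₁, h₂⟩ := small _ _ (show nrm y₁ y₂ ≤ 2 by
    linarith [nrm_nonneg (2 * x₁ + y₁ + 3 * y₂) (2 * x₂ - y₁)])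
  obtain ⟨h₃, h₄⟩ := small _ _ (show nrm (2 * x₁ + y₁ + 3 * y₂) (2 * x₂ - y₁) ≤ 2 by
    linarith [nrm_nonneg y₁ y₂])
  have hy : y₁ = 0 := by
    have : y₁ < 2 := by nlinarith
    have : -2 < y₁ := by nlinarith
    omega
  subst hy h₁
  have hx : x₁ = 0 := by
    have : x₁ < 1 := by nlinarith
    have : -1 < x₁ := by nlinarith
    omega
  obtain rfl : x₂ = 0 := by omega
  subst hx
  simp [nrm] at hsum

/-- Kneser's neighbour construction at an inert prime `p`, applied to the indecomposable unimodular
form. -/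
lemma HRep.indecomposable_of_sq {p : ℤ} (hp : Prime p) (hpos : 0 < p)
    (hin : ∀ y₁ y₂, p ∣ nrm y₁ y₂ → p ∣ y₁ ∧ p ∣ y₂) (h : HRep 2 0 1 2 (p ^ 2)) :
    HRep 2 0 1 2 p := by
  have main : ∀ x₁ x₂ y₁ y₂ : ℤ, herm 2 0 1 2 x₁ x₂ y₁ y₂ = p ^ 2 → ¬ (p ∣ y₁ ∧ p ∣ y₂) →
      HRep 2 0 1 2 p := by
    intro x₁ x₂ y₁ y₂ h hy
    obtain ⟨a, b, hab⟩ := (hp.coprime_iff_not_dvd).2 fun hd => hy (hin _ _ hd)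
    set t₁ := b * (x₁ * (y₁ + y₂) + 3 * x₂ * y₂) with ht₁
    set t₂ := b * (x₂ * y₁ - x₁ * y₂) with ht₂
    have hx₁ : x₁ = t₁ * y₁ - 3 * t₂ * y₂ + p * (a * x₁) := by
      rw [ht₁, ht₂]
      simp only [nrm] at hab
      linear_combination -x₁ * hab
    have hx₂ : x₂ = t₁ * y₂ + t₂ * y₁ + t₂ * y₂ + p * (a * x₂) := by
      rw [ht₁, ht₂]
      simp only [nrm] at hab
      linear_combination -x₂ * hab
    clear_value t₁ t₂
    have hscale : ∀ u₁ u₂, herm 2 0 1 2 (t₁ * u₁ - 3 * t₂ * u₂) (t₁ * u₂ + t₂ * u₁ + t₂ * u₂) u₁ u₂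
        = nrm u₁ u₂ * herm 2 0 1 2 t₁ t₂ 1 0 := by
      intros
      simp only [herm, nrm]
      ring
    have hdvd : p ∣ nrm y₁ y₂ * herm 2 0 1 2 t₁ t₂ 1 0 := by
      rw [← hscale]
      have e₁ : t₁ * y₁ - 3 * t₂ * y₂ = x₁ - p * (a * x₁) := by linarith
      have e₂ : t₁ * y₂ + t₂ * y₁ + t₂ * y₂ = x₂ - p * (a * x₂) := by linarith
      rw [e₁, e₂, ← dvd_sub_left (show p ∣ herm 2 0 1 2 x₁ x₂ y₁ y₂ by
        rw [h]; exact dvd_pow_self p two_ne_zero)]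
      refine ⟨2 * (a * (p * a - 2)) * nrm x₁ x₂ - a * (herm 0 0 1 0 x₁ x₂ y₁ y₂), ?_⟩
      simp only [herm, nrm]
      ring
    obtain ⟨k, hk⟩ := (hp.dvd_or_dvd hdvd).resolve_left fun hd => hy (hin _ _ hd)
    have hdet : k * (2 * p) - nrm (2 * t₁ + 1) (2 * t₂ - 1) = 1 := by
      simp only [herm, nrm] at hk ⊢
      linarith
    have hkpos : 0 < k := by
      have := nrm_nonneg (2 * t₁ + 1) (2 * t₂ - 1)
      nlinarith
    have hG : ∀ l₁ l₂ m₁ m₂, p * herm k (2 * t₁ + 1) (2 * t₂ - 1) (2 * p) l₁ l₂ m₁ m₂ =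
        herm 2 0 1 2 (t₁ * l₁ - 3 * t₂ * l₂ + p * m₁) (t₁ * l₂ + t₂ * l₁ + t₂ * l₂ + p * m₂)
          l₁ l₂ := by
      intro l₁ l₂ m₁ m₂
      simp only [herm, nrm] at hk ⊢
      linear_combination -(l₁ ^ 2 + l₁ * l₂ + 3 * l₂ ^ 2) * hk
    rcases hrep_of_det_eq_one hkpos hdet with hR | hN
    · obtain ⟨l₁, l₂, m₁, m₂, hl⟩ := (hR 1).2 ⟨1, 0, 0, 0, by norm_num [herm, nrm]⟩
      refine ⟨_, _, _, _, (hG l₁ l₂ m₁ m₂).symm.trans ?_⟩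
      rw [hl, mul_one]
    · refine (hN p).1 ⟨y₁, y₂, a * x₁, a * x₂, mul_left_cancel₀ hp.ne_zero ?_⟩
      rw [hG, ← hx₁, ← hx₂, h, pow_two]
  obtain ⟨x₁, x₂, y₁, y₂, h⟩ := h
  by_cases hy : p ∣ y₁ ∧ p ∣ y₂
  swap
  · exact main _ _ _ _ h hy
  by_cases hx : p ∣ x₁ ∧ p ∣ x₂
  · obtain ⟨⟨u₁, rfl⟩, ⟨u₂, rfl⟩⟩ := hx
    obtain ⟨⟨v₁, rfl⟩, ⟨v₂, rfl⟩⟩ := hy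
    refine absurd (mul_left_cancel₀ (pow_ne_zero 2 hp.ne_zero)
      (Eq.trans ?_ (h.trans (mul_one _).symm))) (herm_indecomposable_ne_one u₁ u₂ v₁ v₂)
    simp only [herm, nrm]
    ring
  · refine main (y₁ + y₂) (-y₂) (x₁ + x₂) (-x₂) ?_ fun ⟨h₁, h₂⟩ => hx ?_
    · rw [← h]
      simp only [herm, nrm]
      ring
    · rw [dvd_neg] at h₂
      exact ⟨(dvd_add_left h₂).1 h₁, h₂⟩

lemma dvd_of_dvd_four_mul {p : ℕ} (hodd : p % 2 = 1) {m : ℤ} (h : (p : ℤ) ∣ 4 * m) :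
    (p : ℤ) ∣ m := by
  refine IsCoprime.dvd_of_dvd_mul_left ?_ h
  have : IsCoprime (p : ℤ) ((2 ^ 2 : ℕ) : ℤ) :=
    Nat.isCoprime_iff_coprime.2 (Nat.Coprime.pow_right 2 (Nat.coprime_two_right.2
      (Nat.odd_iff.2 hodd)))
  simpa using this

lemma exists_dvd_nrm_add_one {p : ℕ} [Fact p.Prime] (h2 : p ≠ 2) (h11 : p ≠ 11) :
    ∃ t₁ t₂ : ℤ, (p : ℤ) ∣ nrm t₁ t₂ + 1 := by
  have hodd : p % 2 = 1 := (Fact.out : p.Prime).eq_two_or_odd.resolve_left h2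
  have h11' : (11 : ZMod p) ≠ 0 := by
    intro h
    have : p ∣ 11 := (ZMod.natCast_eq_zero_iff 11 p).1 (by exact_mod_cast h)
    exact h11 ((Nat.prime_dvd_prime_iff_eq Fact.out (by norm_num)).1 this)
  obtain ⟨a, b, hab⟩ := FiniteField.exists_root_sum_quadratic (R := ZMod p)
    (f := .X ^ 2 + .C 4) (g := .C 11 * .X ^ 2) (by compute_degree!)
    (Polynomial.degree_C_mul_X_pow 2 h11') (by rwa [ZMod.card])
  simp only [Polynomial.eval_add, Polynomial.eval_pow, Polynomial.eval_X, Polynomial.eval_C,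
    Polynomial.eval_mul] at hab
  obtain ⟨v, rfl⟩ := ZMod.intCast_surjective b
  obtain ⟨t, ht⟩ : ∃ t : ℤ, ((2 * t + v : ℤ) : ZMod p) = a := by
    obtain ⟨u, rfl⟩ := ZMod.intCast_surjective a
    rcases Int.even_or_odd' (u - v) with ⟨t, ht | ht⟩
    · exact ⟨t, by rw [show 2 * t + v = u by omega]⟩
    · refine ⟨t + (p + 1) / 2, ?_⟩
      rw [show 2 * (t + ((p : ℤ) + 1) / 2) + v = u + p by omega]
      simp
  refine ⟨t, v, ?_⟩
  have h4 : (p : ℤ) ∣ 4 * (nrm t v + 1) := by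
    rw [← ZMod.intCast_zmod_eq_zero_iff_dvd]
    rw [← ht] at hab
    simp only [nrm]
    push_cast at hab ⊢
    linear_combination hab
  exact dvd_of_dvd_four_mul hodd h4

/-- A prime other than `2` and `11` is a value of one of the two unimodular forms. -/
lemma hrep_or_hrep_of_prime {p : ℕ} [Fact p.Prime] (h2 : p ≠ 2) (h11 : p ≠ 11) :
    HRep 1 0 0 1 p ∨ HRep 2 0 1 2 p := by
  obtain ⟨t₁, t₂, k, hk⟩ := exists_dvd_nrm_add_one h2 h11
  have hrep : HRep p t₁ t₂ k p := ⟨1, 0, 0, 0, by simp [herm, nrm]⟩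
  rcases hrep_of_det_eq_one (by exact_mod_cast (Fact.out : p.Prime).pos)
    (show (p : ℤ) * k - nrm t₁ t₂ = 1 by linarith) with h | h
  · exact .inl ((h _).1 hrep)
  · exact .inr ((h _).1 hrep)

lemma indecomposable_or_sq_of_sum_sq {n a b c d : ℤ} (hodd : n % 2 = 1) (hsq : ¬ IsSquare n)
    (hsq' : ¬ IsSquare (11 * n)) (h : n = a ^ 2 + b ^ 2 + 11 * c ^ 2 + 11 * d ^ 2) :
    HRep 2 0 1 2 n ∨ HRep 2 0 1 2 (n ^ 2) := by
  have sq_mod : ∀ x : ℤ, x ^ 2 % 2 = x % 2 := fun x => by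
    rcases Int.even_or_odd' x with ⟨k, rfl | rfl⟩ <;> ring_nf <;> omega
  have hpar : (a + b + c + d) % 2 = 1 := by
    have ha := sq_mod a
    have hb := sq_mod b
    have hc := sq_mod c
    have hd := sq_mod d
    omega
  have direct : ∀ {a b : ℤ}, n = a ^ 2 + b ^ 2 + 11 * c ^ 2 + 11 * d ^ 2 → a % 2 = 1 →
      (b % 2 = 1 ∧ (c % 2 = 1 ∨ d % 2 = 1) ∨ b % 2 = 0 ∧ c % 2 = 0 ∧ d % 2 = 0) →
      HRep 2 0 1 2 n ∨ HRep 2 0 1 2 (n ^ 2) := by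
    intro a b h ha hb
    refine hrep_indecomposable_or_sq hodd (h.trans (by simp only [tern]; ring)) ha ?_ hb
    by_contra! hv
    obtain ⟨rfl, rfl, rfl⟩ := hv
    exact hsq ⟨a, by rw [h]; ring⟩
  have scaled : ∀ {c d : ℤ}, n = a ^ 2 + b ^ 2 + 11 * c ^ 2 + 11 * d ^ 2 → c % 2 = 1 →
      (d % 2 = 1 ∧ (a % 2 = 1 ∨ b % 2 = 1) ∨ d % 2 = 0 ∧ a % 2 = 0 ∧ b % 2 = 0) →
      HRep 2 0 1 2 n ∨ HRep 2 0 1 2 (n ^ 2) := by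
    intro c d h hc hd
    have := hrep_indecomposable_or_sq (n := 11 * n) (a := 11 * c) (b := 11 * d) (c := a) (d := b)
      (by omega) (by rw [h]; simp only [tern]; ring) (by omega) ?_ (by omega)
    · refine this.imp HRep.indecomposable_of_eleven_mul fun h => ?_
      refine (HRep.indecomposable_of_eleven_mul (HRep.indecomposable_of_eleven_mul ?_))
      convert h using 1
      ring
    · by_contra! hv
      obtain ⟨hd0, rfl, rfl⟩ := hv
      obtain rfl : d = 0 := by omega
      exact hsq' ⟨11 * c, by rw [h]; ring⟩
  have h' : n = b ^ 2 + a ^ 2 + 11 * c ^ 2 + 11 * d ^ 2 := by rw [h]; ring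
  have h'' : n = a ^ 2 + b ^ 2 + 11 * d ^ 2 + 11 * c ^ 2 := by rw [h]; ring
  rcases Int.emod_two_eq_zero_or_one a with ha | ha <;>
  rcases Int.emod_two_eq_zero_or_one b with hb | hb <;>
  rcases Int.emod_two_eq_zero_or_one c with hc | hc <;>
  rcases Int.emod_two_eq_zero_or_one d with hd | hd <;>
  first
  | exact direct h ha (by omega)
  | exact direct h' hb (by omega)
  | exact scaled h hc (by omega)
  | exact scaled h'' hd (by omega)
  | omega

lemma HRep.indecomposable_or_sq {n : ℤ} (hodd : n % 2 = 1) (hsq : ¬ IsSquare n)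
    (hsq' : ¬ IsSquare (11 * n)) (h : HRep 1 0 0 1 n) :
    HRep 2 0 1 2 n ∨ HRep 2 0 1 2 (n ^ 2) := by
  obtain ⟨x₁, x₂, y₁, y₂, h⟩ := h
  simp only [herm, nrm] at h
  have h4 : 4 * n = (2 * x₁ + x₂) ^ 2 + (2 * y₁ + y₂) ^ 2 + 11 * x₂ ^ 2 + 11 * y₂ ^ 2 := by
    linarith
  rcases Int.even_or_odd' x₂ with ⟨c, rfl | rfl⟩ <;> rcases Int.even_or_odd' y₂ with ⟨d, rfl | rfl⟩
  · exact indecomposable_or_sq_of_sum_sq (a := x₁ + c) (b := y₁ + d) (c := c) (d := d) hodd hsq hsq'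
      (by linarith)
  · exact .inl (hrep_indecomposable_of_four_mul_eq (A := 2 * x₁ + 2 * c) (B := 2 * y₁ + (2 * d + 1))
      (C := 2 * c) (D := 2 * d + 1) hodd (by omega) (by omega) (by omega)
      (by rw [h4]; simp only [tern]; ring))
  · exact .inl (hrep_indecomposable_of_four_mul_eq (A := 2 * y₁ + 2 * d) (B := 2 * x₁ + (2 * c + 1))
      (C := 2 * c + 1) (D := 2 * d) hodd (by omega) (by omega) (by omega)
      (by rw [h4]; simp only [tern]; ring))
  · exfalso
    clear hsq hsq'
    rcases Int.even_or_odd' x₁ with ⟨e, rfl | rfl⟩ <;>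
    rcases Int.even_or_odd' y₁ with ⟨f, rfl | rfl⟩ <;>
    ring_nf at h <;> omega

lemma HRep.indecomposable_of_inert {p : ℕ} [Fact p.Prime] (h11 : p ≠ 11)
    (hin : ∀ y₁ y₂, (p : ℤ) ∣ nrm y₁ y₂ → (p : ℤ) ∣ y₁ ∧ (p : ℤ) ∣ y₂) : HRep 2 0 1 2 p := by
  have hp : p.Prime := Fact.out
  have hpZ : Prime (p : ℤ) := Nat.prime_iff_prime_int.1 hp
  rcases eq_or_ne p 2 with rfl | h2
  · exact ⟨1, 0, 0, 0, by norm_num [herm, nrm]⟩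
  rcases hrep_or_hrep_of_prime h2 h11 with h | h
  swap
  · exact h
  have hodd : p % 2 = 1 := hp.eq_two_or_odd.resolve_left h2
  have hsq : ¬ IsSquare (11 * (p : ℤ)) := by
    rintro ⟨r, hr⟩
    obtain ⟨s, rfl⟩ : (p : ℤ) ∣ r := by
      simpa using hpZ.dvd_or_dvd (Dvd.intro_left _ hr)
    have : (11 : ℤ) = p * (s * s) := mul_right_cancel₀ hpZ.ne_zero (by rw [hr]; ring)
    have : p ∣ 11 := by exact_mod_cast Dvd.intro _ this.symm
    exact h11 ((Nat.prime_dvd_prime_iff_eq hp (by norm_num)).1 this)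
  rcases h.indecomposable_or_sq (by omega) hpZ.irreducible.not_isSquare hsq with h | h
  · exact h
  · exact h.indecomposable_of_sq hpZ (by exact_mod_cast hp.pos) hin

lemma hrep_eleven_of_cast_eq_zero {h₁ h₂ d₁ d₂ : ℤ}
    (h : (h₁ : ZMod 11) + 6 * h₂ = 0 ∨ (d₁ : ZMod 11) + 6 * d₂ = 0) :
    HRep 1 0 0 11 (nrm h₁ h₂ + nrm d₁ d₂) := by
  wlog hd : (d₁ : ZMod 11) + 6 * d₂ = 0 generalizing h₁ h₂ d₁ d₂
  · rw [add_comm]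
    exact this h.symm (h.resolve_right hd)
  obtain ⟨w₁, w₂, rfl, rfl⟩ := exists_sqrt_mul_of_cast_eq_zero hd
  refine ⟨h₁, h₂, w₁, w₂, ?_⟩
  simp only [herm, nrm]
  ring

/-- The Gram identity `N(x) N(u) = |⟨x, u⟩|² + |det(x, u)|²` for the indecomposable unimodular form,
together with the residues modulo `√-11`. -/
lemma exists_nrm_add_nrm_eq_herm_mul_herm (x₁ x₂ y₁ y₂ u₁ u₂ v₁ v₂ : ℤ) {X Y U V : ZMod 11}
    (hX : X = x₁ + 6 * x₂) (hY : Y = y₁ + 6 * y₂) (hU : U = u₁ + 6 * u₂) (hV : V = v₁ + 6 * v₂) :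
    ∃ h₁ h₂ d₁ d₂ : ℤ,
      nrm h₁ h₂ + nrm d₁ d₂ = herm 2 0 1 2 x₁ x₂ y₁ y₂ * herm 2 0 1 2 u₁ u₂ v₁ v₂ ∧
      (h₁ : ZMod 11) + 6 * h₂ = 2 * X * U + 6 * X * V + 6 * Y * U + 2 * Y * V ∧
      (d₁ : ZMod 11) + 6 * d₂ = X * V - Y * U := by
  refine ⟨2 * (x₁ * (u₁ + u₂) + 3 * x₂ * u₂) - 3 * (x₂ * v₁ - x₁ * v₂)
      + (y₁ * (u₁ + u₂) + 3 * y₂ * u₂) + 3 * (y₂ * u₁ - y₁ * u₂)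
      + 2 * (y₁ * (v₁ + v₂) + 3 * y₂ * v₂),
    2 * (x₂ * u₁ - x₁ * u₂) + (x₁ * (v₁ + v₂) + 3 * x₂ * v₂) + (x₂ * v₁ - x₁ * v₂)
      - (y₁ * (u₁ + u₂) + 3 * y₂ * u₂) + 2 * (y₂ * v₁ - y₁ * v₂),
    x₁ * v₁ - 3 * x₂ * v₂ - (y₁ * u₁ - 3 * y₂ * u₂),
    x₁ * v₂ + x₂ * v₁ + x₂ * v₂ - (y₁ * u₂ + y₂ * u₁ + y₂ * u₂), ?_, ?_, ?_⟩
  · simp only [herm, nrm]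
    ring
  · subst X Y U V
    push_cast
    grind
  · subst X Y U V
    push_cast
    grind

lemma HRep.mul_of_isSquare {m n : ℤ} (hm : HRep 2 0 1 2 m) (hn : HRep 2 0 1 2 n)
    (hsq : IsSquare ((m * n : ℤ) : ZMod 11)) (h0 : ((m * n : ℤ) : ZMod 11) ≠ 0) :
    HRep 1 0 0 11 (m * n) := by
  have cover : ∀ H D : ZMod 11, IsSquare (H ^ 2 + D ^ 2) → H ^ 2 + D ^ 2 ≠ 0 →
      (H = 0 ∨ D = 0) ∨ (5 * H + 3 * D = 0 ∨ 8 * H + 5 * D = 0) ∨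
        (5 * H + 8 * D = 0 ∨ 3 * H + 5 * D = 0) := by decide
  obtain ⟨x₁, x₂, y₁, y₂, rfl⟩ := hm
  obtain ⟨u₁, u₂, v₁, v₂, rfl⟩ := hn
  obtain ⟨X, hX⟩ : ∃ X : ZMod 11, X = x₁ + 6 * x₂ := ⟨_, rfl⟩
  obtain ⟨Y, hY⟩ : ∃ Y : ZMod 11, Y = y₁ + 6 * y₂ := ⟨_, rfl⟩
  obtain ⟨U, hU⟩ : ∃ U : ZMod 11, U = u₁ + 6 * u₂ := ⟨_, rfl⟩
  obtain ⟨V, hV⟩ : ∃ V : ZMod 11, V = v₁ + 6 * v₂ := ⟨_, rfl⟩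
  have rotX : ∀ {x₁ x₂ y₁ y₂ : ℤ} {X Y : ZMod 11}, X = x₁ + 6 * x₂ → Y = y₁ + 6 * y₂ →
      9 * X + 5 * Y = ((-2 * x₁ - y₁ - 3 * y₂ : ℤ) : ZMod 11) + 6 * ((-2 * x₂ + y₁ : ℤ) : ZMod 11)
      ∧ 6 * X + Y = ((-3 * x₂ + y₁ : ℤ) : ZMod 11) + 6 * ((x₁ + x₂ + y₂ : ℤ) : ZMod 11) := by
    intro x₁ x₂ y₁ y₂ X Y hX hY
    push_cast
    subst hX hY
    constructor <;> grind
  obtain ⟨h₁, h₂, d₁, d₂, e, hH, hD⟩ :=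
    exists_nrm_add_nrm_eq_herm_mul_herm x₁ x₂ y₁ y₂ u₁ u₂ v₁ v₂ hX hY hU hV
  obtain ⟨hX', hY'⟩ := rotX hX hY
  obtain ⟨hX'', hY''⟩ := rotX hX' hY'
  obtain ⟨h₁', h₂', d₁', d₂', e', hH', hD'⟩ :=
    exists_nrm_add_nrm_eq_herm_mul_herm _ _ _ _ u₁ u₂ v₁ v₂ hX' hY' hU hV
  obtain ⟨h₁'', h₂'', d₁'', d₂'', e'', hH'', hD''⟩ :=
    exists_nrm_add_nrm_eq_herm_mul_herm _ _ _ _ u₁ u₂ v₁ v₂ hX'' hY'' hU hV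
  simp only [herm_rotate] at e' e''
  have hres : ((nrm h₁ h₂ + nrm d₁ d₂ : ℤ) : ZMod 11) =
      ((h₁ : ZMod 11) + 6 * h₂) ^ 2 + ((d₁ : ZMod 11) + 6 * d₂) ^ 2 := by
    simp only [nrm]
    push_cast
    grind
  rw [← e, hres] at hsq h0
  rcases cover _ _ hsq h0 with h | h | h
  · rw [← e]
    exact hrep_eleven_of_cast_eq_zero h
  · rw [← e']
    refine hrep_eleven_of_cast_eq_zero ?_
    rw [hH', hD']
    rw [hH, hD] at h
    refine h.imp (fun h => ?_) fun h => ?_ <;> grind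
  · rw [← e'']
    refine hrep_eleven_of_cast_eq_zero ?_
    rw [hH'', hD'']
    rw [hH, hD] at h
    refine h.imp (fun h => ?_) fun h => ?_ <;> grind

/-- The binary forms of discriminant `-11` form a single class. -/
lemma exists_nrm_eq_of_discrim {a b c : ℤ} (ha : 0 < a) (hdet : 4 * a * c - b ^ 2 = 11) (x y : ℤ) :
    ∃ u v, nrm u v = a * x ^ 2 + b * x * y + c * y ^ 2 := by
  induction hk : a.toNat using Nat.strong_induction_on generalizing a b c x y with
  | _ k ih =>
    subst hk
    obtain ⟨r, hr⟩ := exists_abs_two_mul_add_mul_le (a := 2 * a) (by omega) b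
    obtain ⟨B, hB⟩ : ∃ B, B = b + 2 * a * r := ⟨_, rfl⟩
    obtain ⟨C, hC⟩ : ∃ C, C = c + b * r + a * r ^ 2 := ⟨_, rfl⟩
    have hdet' : 4 * a * C - B ^ 2 = 11 := by rw [hB, hC, ← hdet]; ring
    have hval : a * x ^ 2 + b * x * y + c * y ^ 2 =
        a * (x - r * y) ^ 2 + B * (x - r * y) * y + C * y ^ 2 := by rw [hB, hC]; ring
    rw [hval]
    rw [← hB] at hr
    have hC0 : 0 < C := by nlinarith [sq_nonneg B]
    rcases lt_or_ge C a with hlt | hge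
    · obtain ⟨u, v, h⟩ := ih C.toNat (by omega) hC0 (b := B) (c := a) (by linarith) y (x - r * y) rfl
      exact ⟨u, v, by rw [h]; ring⟩
    · rw [abs_le] at hr
      have hB2 : B ^ 2 ≤ a ^ 2 := by nlinarith
      obtain rfl : a = 1 := by nlinarith
      have h₁ : -1 ≤ B := by linarith
      have h₂ : B ≤ 1 := by linarith
      interval_cases B
      · obtain rfl : C = 3 := by linarith
        exact ⟨x - r * y, -y, by simp only [nrm]; ring⟩
      · omega
      · obtain rfl : C = 3 := by linarith
        exact ⟨x - r * y, y, by simp only [nrm]; ring⟩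

lemma exists_nrm_eq_of_dvd_nrm_one {p t : ℤ} (hp : 0 < p) (h : p ∣ nrm t 1) :
    ∃ u v, nrm u v = p := by
  obtain ⟨k, hk⟩ := h
  obtain ⟨u, v, huv⟩ := exists_nrm_eq_of_discrim (b := 2 * t + 1) (c := k) hp
    (by simp only [nrm] at hk; linear_combination -4 * hk) 1 0
  exact ⟨u, v, by rw [huv]; ring⟩

lemma exists_nrm_eq_or_inert {p : ℤ} (hp : Prime p) (hpos : 0 < p) :
    (∃ u v, nrm u v = p) ∨ ∀ y₁ y₂, p ∣ nrm y₁ y₂ → p ∣ y₁ ∧ p ∣ y₂ := by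
  by_contra! h
  obtain ⟨hn, y₁, y₂, hd, hy⟩ := h
  have hy₂ : ¬ p ∣ y₂ := by
    refine fun h₂ => hy (hp.dvd_of_dvd_pow (n := 2) ?_) h₂
    have e : y₁ ^ 2 = nrm y₁ y₂ - y₂ * (y₁ + 3 * y₂) := by simp only [nrm]; ring
    rw [e]
    exact dvd_sub hd (h₂.mul_right _)
  obtain ⟨a, b, hab⟩ := (hp.coprime_iff_not_dvd).2 hy₂
  obtain ⟨u, v, huv⟩ := exists_nrm_eq_of_dvd_nrm_one (t := y₁ * b) hpos (by
    have e : nrm (y₁ * b) 1 = b ^ 2 * nrm y₁ y₂ + p * (a * (y₁ * b + 6 - 3 * (a * p))) := by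
      simp only [nrm]
      linear_combination -(y₁ * b + 3 * (b * y₂ + 1 - a * p)) * hab
    rw [e]
    exact dvd_add (hd.mul_left _) (dvd_mul_right _ _))
  exact hn u v huv

lemma exists_nrm_eq_of_isSquare {p : ℕ} [Fact p.Prime] (h2 : p ≠ 2) (h11 : p ≠ 11)
    (hsq : IsSquare (p : ZMod 11)) : ∃ u v, nrm u v = p := by
  have : Fact (Nat.Prime 11) := ⟨by norm_num⟩
  have hodd : p % 2 = 1 := (Fact.out : p.Prime).eq_two_or_odd.resolve_left h2
  have hneg : IsSquare (-11 : ZMod p) := by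
    rcases (show p % 4 = 1 ∨ p % 4 = 3 by omega) with h4 | h4
    · have h := (ZMod.exists_sq_eq_prime_iff_of_mod_four_eq_one h4 (q := 11) (by norm_num)).2 hsq
      have h' : IsSquare (-1 : ZMod p) := ZMod.exists_sq_eq_neg_one_iff.2 (by omega)
      simpa using h'.mul h
    · have h := (ZMod.exists_sq_eq_prime_iff_of_mod_four_eq_three (p := 11) (by norm_num) h4
        (Ne.symm h11)).1 hsq
      have h' : ¬ IsSquare (-1 : ZMod p) := by rw [ZMod.exists_sq_eq_neg_one_iff]; omega
      have hl := (legendreSym.eq_neg_one_iff p (a := 11)).2 (by simpa using h)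
      have hl' := (legendreSym.eq_neg_one_iff p (a := -1)).2 (by simpa using h')
      have hmul : legendreSym p (-11) = 1 := by
        rw [show (-11 : ℤ) = -1 * 11 by norm_num, legendreSym.mul, hl, hl']
        norm_num
      have hne : ((-11 : ℤ) : ZMod p) ≠ 0 := fun h0 => by
        rw [(legendreSym.eq_zero_iff p _).2 h0] at hmul
        exact zero_ne_one hmul
      simpa using (legendreSym.eq_one_iff p hne).1 hmul
  obtain ⟨r, hr⟩ := hneg
  obtain ⟨s, rfl⟩ := ZMod.intCast_surjective r
  obtain ⟨t, ht⟩ : ∃ t : ℤ, ((2 * t + 1 : ℤ) : ZMod p) = s := by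
    rcases Int.even_or_odd' s with ⟨t, ht | ht⟩
    · refine ⟨t + (p - 1) / 2, ?_⟩
      rw [show 2 * (t + ((p : ℤ) - 1) / 2) + 1 = s + p by omega]
      simp
    · exact ⟨t, by rw [ht]⟩
  refine exists_nrm_eq_of_dvd_nrm_one (t := t) (by exact_mod_cast (Fact.out : p.Prime).pos) ?_
  have h4 : (p : ℤ) ∣ 4 * nrm t 1 := by
    rw [← ZMod.intCast_zmod_eq_zero_iff_dvd]
    rw [← ht] at hr
    simp only [nrm]
    push_cast at hr ⊢
    linear_combination -hr
  exact dvd_of_dvd_four_mul hodd h4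

lemma Nat.Prime.exists_nrm_eq_or_indecomposable {p : ℕ} (hp : p.Prime) :
    (∃ u v, nrm u v = p) ∨ ¬ IsSquare (p : ZMod 11) ∧ HRep 2 0 1 2 p := by
  have := Fact.mk hp
  by_cases h : ∃ u v, nrm u v = p
  · exact .inl h
  have h11 : p ≠ 11 := by
    rintro rfl
    exact h ⟨-1, 2, by norm_num [nrm]⟩
  have hin := (exists_nrm_eq_or_inert (Nat.prime_iff_prime_int.1 hp)
    (by exact_mod_cast hp.pos)).resolve_left h
  refine .inr ⟨fun hsq => ?_, HRep.indecomposable_of_inert h11 hin⟩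
  rcases eq_or_ne p 2 with rfl | h2
  · exact absurd hsq (by decide)
  · exact h (exists_nrm_eq_of_isSquare h2 h11 hsq)

lemma hrep_nrm (c u v : ℤ) : HRep 1 0 0 c (nrm u v) := ⟨u, v, 0, 0, by simp [herm, nrm]⟩

theorem hrep_one_one (n : ℕ) : HRep 1 0 0 1 n := by
  induction n using Nat.recOnMul with
  | zero => exact ⟨0, 0, 0, 0, rfl⟩
  | one => exact ⟨1, 0, 0, 0, rfl⟩
  | prime p hp =>
    rcases hp.exists_nrm_eq_or_indecomposable with ⟨u, v, h⟩ | ⟨-, h⟩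
    · rw [← h]
      exact hrep_nrm 1 u v
    · exact h.of_indecomposable
  | mul a b ha hb =>
    push_cast
    exact ha.mul hb

lemma hrep_eleven_of_eleven_mul (m : ℕ) : HRep 1 0 0 11 (11 * m) := by
  obtain ⟨x₁, x₂, y₁, y₂, h⟩ := hrep_one_one m
  refine ⟨-x₁ - 6 * x₂, 2 * x₁ + x₂, y₁, y₂, ?_⟩
  rw [← h]
  simp only [herm, nrm]
  ring

lemma cast_nrm (u v : ℤ) : ((nrm u v : ℤ) : ZMod 11) = ((u : ZMod 11) + 6 * v) ^ 2 := by
  simp only [nrm]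
  push_cast
  grind

theorem hrep_eleven_of_isSquare {n : ℕ} (h0 : (n : ZMod 11) ≠ 0) (hsq : IsSquare (n : ZMod 11)) :
    HRep 1 0 0 11 n := by
  have div : ∀ a b : ZMod 11, a * b ≠ 0 → IsSquare (a * b) → IsSquare a → b ≠ 0 ∧ IsSquare b := by
    decide
  have mul : ∀ a b : ZMod 11, ¬ IsSquare a → ¬ IsSquare b → IsSquare (a * b) := by decide
  induction n using Nat.strong_induction_on with
  | _ n ih =>
    have hn : 0 < n := Nat.pos_of_ne_zero fun h => h0 (by rw [h]; rfl)
    have peel : ∀ a b : ℕ, n = a * b → 1 < a → IsSquare (a : ZMod 11) → HRep 1 0 0 11 a →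
        HRep 1 0 0 11 n := by
      rintro a b rfl ha hsqa hrep
      push_cast at h0 hsq ⊢
      obtain ⟨hb0, hb⟩ := div _ _ h0 hsq hsqa
      exact hrep.mul (ih b (lt_mul_of_one_lt_left (Nat.pos_of_mul_pos_left hn) ha) hb0 hb)
    have peel_nrm : ∀ p b : ℕ, p.Prime → n = p * b → (∃ u v, nrm u v = p) → HRep 1 0 0 11 n := by
      rintro p b hp hpb ⟨u, v, huv⟩
      refine peel p b hpb hp.one_lt ⟨u + 6 * v, ?_⟩ ?_
      · rw [← pow_two, ← cast_nrm, huv, Int.cast_natCast]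
      · rw [← huv]
        exact hrep_nrm 11 u v
    rcases eq_or_ne n 1 with rfl | h1
    · exact ⟨1, 0, 0, 0, rfl⟩
    obtain ⟨p, hp, k, hk⟩ := Nat.exists_prime_and_dvd h1
    rcases hp.exists_nrm_eq_or_indecomposable with h | ⟨hps, hpr⟩
    · exact peel_nrm p k hp hk h
    have hk1 : k ≠ 1 := by
      rintro rfl
      rw [mul_one] at hk
      exact hps (hk ▸ hsq)
    obtain ⟨q, hq, l, rfl⟩ := Nat.exists_prime_and_dvd hk1
    rcases hq.exists_nrm_eq_or_indecomposable with h | ⟨hqs, hqr⟩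
    · exact peel_nrm q (p * l) hq (by rw [hk]; ring) h
    have hpq := mul _ _ hps hqs
    refine peel (p * q) l (by rw [hk]; ring) (Nat.one_lt_mul_iff.2 ⟨hp.pos, hq.pos, .inl hp.one_lt⟩)
      (by exact_mod_cast hpq) ?_
    push_cast
    refine hpr.mul_of_isSquare hqr (by push_cast; exact hpq) fun h => h0 ?_
    rw [hk]
    push_cast at h ⊢
    rw [← mul_assoc, h, zero_mul]

theorem stmt_19 (n : ℤ) (hn : 0 ≤ n) :
    (∃ x1 x2 y1 y2 : ℤ, x1^2 + x1*x2 + 3*x2^2 + 11*y1^2 + 11*y1*y2 + 33*y2^2 = n) ↔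
    (n % 11 = 0 ∨ n % 11 = 1 ∨ n % 11 = 3 ∨ n % 11 = 4 ∨ n % 11 = 5 ∨ n % 11 = 9) := by
  have hherm : ∀ x₁ x₂ y₁ y₂ : ℤ, x₁ ^ 2 + x₁ * x₂ + 3 * x₂ ^ 2 + 11 * y₁ ^ 2 + 11 * y₁ * y₂
      + 33 * y₂ ^ 2 = herm 1 0 0 11 x₁ x₂ y₁ y₂ := by
    intros
    simp only [herm, nrm]
    ring
  have hsq : ∀ z : ZMod 11, IsSquare z ↔ z = 0 ∨ z = 1 ∨ z = 3 ∨ z = 4 ∨ z = 5 ∨ z = 9 := by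
    decide
  have hmod : ∀ r : ℤ, 0 ≤ r → r < 11 → ((n : ZMod 11) = r ↔ n % 11 = r) := by
    intro r h₀ h₁
    rw [ZMod.intCast_eq_intCast_iff', Nat.cast_ofNat, Int.emod_eq_of_lt h₀ h₁]
  have key : IsSquare (n : ZMod 11) ↔
      (n % 11 = 0 ∨ n % 11 = 1 ∨ n % 11 = 3 ∨ n % 11 = 4 ∨ n % 11 = 5 ∨ n % 11 = 9) := by
    rw [hsq, ← hmod 0, ← hmod 1, ← hmod 3, ← hmod 4, ← hmod 5, ← hmod 9] <;> norm_num
  simp only [hherm]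
  rw [← key]
  constructor
  · rintro ⟨x₁, x₂, y₁, y₂, rfl⟩
    refine ⟨x₁ + 6 * x₂, ?_⟩
    simp only [herm, nrm]
    push_cast
    grind
  · intro h
    lift n to ℕ using hn
    rw [Int.cast_natCast] at h
    by_cases h0 : (n : ZMod 11) = 0
    · obtain ⟨m, rfl⟩ := (ZMod.natCast_eq_zero_iff n 11).1 h0
      exact_mod_cast hrep_eleven_of_eleven_mul m
    · exact hrep_eleven_of_isSquare h0 h
end
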